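/- arXiv:2203.00248 — 2 statements merged into one kernel-verified Lean document; each statement's English description precedes it below -/
import Mathlib

section
/- Let n ≥ 3 be an integer and s a non-negative integer with s ≤ 92. Then g₁(x) = g₁(x,n,s) is either irreducible over ℚ or is the product of a polynomial of degree 1 and an irreducible polynomial in ℚ[x]. -/
open Polynomial Finset

/-- g₁(x,n,s) = n!·∑_{j=0}^{n} C(n+s−j, n−j)·x^j/j!, as a polynomial over ℚ. -/
noncomputable def g1 (n s : ℕ) : ℚ[X] :=
  (n.factorial : ℚ[X]) *
    ∑ j ∈ Finset.range (n + 1),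
      Polynomial.C (((n + s - j).choose (n - j) : ℚ) / (j.factorial : ℚ)) * Polynomial.X ^ j

/-- The coefficient of `x ^ j` in `g1 n s`. -/
def cf (n s j : ℕ) : ℕ := n.choose j * (s + 1).ascFactorial (n - j)

/-- `g1 n s` as a polynomial with integer coefficients. -/
noncomputable def gz (n s : ℕ) : ℤ[X] :=
  ∑ j ∈ Finset.range (n + 1), Polynomial.C (cf n s j : ℤ) * Polynomial.X ^ j

theorem gz_coeff {n s j : ℕ} (hj : j ≤ n) : (gz n s).coeff j = cf n s j := by
  simp only [gz, finsetSum_coeff, coeff_C_mul, coeff_X_pow]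
  rw [Finset.sum_eq_single j]
  · simp
  · intro b _ hb
    simp [hb.symm]
  · intro h
    simp at h
    omega

theorem gz_coeff_eq_zero {n s j : ℕ} (hj : n < j) : (gz n s).coeff j = 0 := by
  simp only [gz, finsetSum_coeff, coeff_C_mul, coeff_X_pow]
  refine Finset.sum_eq_zero fun b hb => ?_
  simp at hb
  rw [if_neg (by omega)]
  simp

theorem cf_pos {n s j : ℕ} (hj : j ≤ n) : 0 < cf n s j :=
  Nat.mul_pos (Nat.choose_pos hj) (Nat.ascFactorial_pos s _)

theorem gz_natDegree (n s : ℕ) : (gz n s).natDegree = n := by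
  refine le_antisymm (natDegree_le_iff_coeff_eq_zero.2 fun N hN => gz_coeff_eq_zero hN) ?_
  refine le_natDegree_of_ne_zero ?_
  rw [gz_coeff le_rfl]
  exact_mod_cast (cf_pos le_rfl).ne'

theorem gz_monic (n s : ℕ) : (gz n s).Monic := by
  rw [Monic, leadingCoeff, gz_natDegree, gz_coeff le_rfl]
  simp [cf]

theorem g1_eq_map (n s : ℕ) : g1 n s = (gz n s).map (Int.castRingHom ℚ) := by
  rw [g1, gz, Polynomial.map_sum, Finset.mul_sum]
  refine Finset.sum_congr rfl fun j hj => ?_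
  have hj : j ≤ n := by simpa [Nat.lt_succ_iff] using hj
  rw [Polynomial.map_mul, Polynomial.map_pow, map_X, map_C, ← mul_assoc, ← C_eq_natCast, ← C_mul]
  congr 2
  simp only [cf, eq_intCast, Int.cast_natCast]
  have h1 : (n.factorial : ℚ) = n.choose j * j.factorial * (n - j).factorial := by
    exact_mod_cast (Nat.choose_mul_factorial_mul_factorial hj).symm
  have h2 : (s + 1).ascFactorial (n - j) = (n - j).factorial * (n + s - j).choose (n - j) := by
    rw [Nat.ascFactorial_eq_factorial_mul_choose]
    congr 2
    omega
  have h3 : (j.factorial : ℚ) ≠ 0 := by positivity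
  rw [h1, h2]
  push_cast
  field_simp

/-- `gz n s` has no monic integral factor of degree `k`. -/
def NoFactor (n s k : ℕ) : Prop :=
  ∀ g h : ℤ[X], g.Monic → h.Monic → gz n s = g * h → g.natDegree ≠ k

theorem exists_linear_factor_of_not_irreducible {p : ℤ[X]} (hp : p.Monic) (hp1 : p ≠ 1)
    (hirr : ¬ Irreducible p)
    (H : ∀ g h : ℤ[X], g.Monic → h.Monic → p = g * h → 2 * g.natDegree ≤ p.natDegree →
      g.natDegree ≤ 1) :
    ∃ l q : ℤ[X], l.Monic ∧ q.Monic ∧ l.natDegree = 1 ∧ p = l * q := by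
  rw [hp.irreducible_iff_natDegree'] at hirr
  push Not at hirr
  obtain ⟨f, g, hf, hg, hfg, hdeg⟩ := hirr hp1
  rw [mem_Ioc] at hdeg
  have hfg' : p = g * f := by rw [← hfg, mul_comm]
  have := H g f hg hf hfg' (by omega)
  exact ⟨g, f, hg, hf, by omega, hfg'⟩

theorem irreducible_or_of_noFactor {n s : ℕ} (hn : 4 ≤ n)
    (H : ∀ k, 2 ≤ k → 2 * k ≤ n → NoFactor n s k) :
    Irreducible (gz n s) ∨ ∃ l q : ℤ[X], l.Monic ∧ q.Monic ∧ l.natDegree = 1 ∧ Irreducible q ∧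
      gz n s = l * q := by
  by_cases hirr : Irreducible (gz n s)
  · exact Or.inl hirr
  right
  have hdeg := gz_natDegree n s
  have hne : gz n s ≠ 1 := by
    intro h
    rw [h, natDegree_one] at hdeg
    omega
  have H' : ∀ g h : ℤ[X], g.Monic → h.Monic → gz n s = g * h → 2 * g.natDegree ≤ n →
      g.natDegree ≤ 1 := by
    intro g h hg hh hgh hd
    by_contra hlt
    exact H g.natDegree (by omega) hd g h hg hh hgh rfl
  obtain ⟨l, q, hl, hq, hl1, hlq⟩ := exists_linear_factor_of_not_irreducible (gz_monic n s) hne hirr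
    (by rwa [hdeg])
  refine ⟨l, q, hl, hq, hl1, ?_, hlq⟩
  have hqdeg : 1 + q.natDegree = n := by
    rw [← hl1, ← hl.natDegree_mul hq, ← hlq, hdeg]
  by_contra hqirr
  obtain ⟨m, r, hm, hr, hm1, hmr⟩ := exists_linear_factor_of_not_irreducible hq
    (by rintro rfl; rw [natDegree_one] at hqdeg; omega) hqirr (by
      intro g h hg hh hgh hd
      refine H' g (l * h) hg (hl.mul hh) ?_ (by omega)
      rw [hlq, hgh]
      ring)
  have := H' (l * m) r (hl.mul hm) hr (by rw [hlq, hmr]; ring)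
    (by rw [hl.natDegree_mul hm]; omega)
  rw [hl.natDegree_mul hm] at this
  omega

theorem irreducible_or_of_three (s : ℕ) :
    Irreducible (gz 3 s) ∨ ∃ l q : ℤ[X], l.Monic ∧ q.Monic ∧ l.natDegree = 1 ∧ Irreducible q ∧
      gz 3 s = l * q := by
  by_cases hirr : Irreducible (gz 3 s)
  · exact Or.inl hirr
  right
  have hdeg := gz_natDegree 3 s
  have hne : gz 3 s ≠ 1 := by
    intro h
    rw [h, natDegree_one] at hdeg
    omega
  obtain ⟨l, q, hl, hq, hl1, hlq⟩ := exists_linear_factor_of_not_irreducible (gz_monic 3 s) hne hirr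
    (by intros; omega)
  refine ⟨l, q, hl, hq, hl1, ?_, hlq⟩
  have hqdeg : 1 + q.natDegree = 3 := by
    rw [← hl1, ← hl.natDegree_mul hq, ← hlq, hdeg]
  by_contra hqirr
  obtain ⟨m, r, hm, hr, hm1, hmr⟩ := exists_linear_factor_of_not_irreducible hq
    (by rintro rfl; rw [natDegree_one] at hqdeg; omega) hqirr (by intros; omega)
  have hr1 : r.natDegree = 1 := by
    have := hm.natDegree_mul hr
    rw [← hmr] at this
    omega
  rw [hmr, hl.eq_X_add_C hl1, hm.eq_X_add_C hm1, hr.eq_X_add_C hr1] at hlq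
  generalize l.coeff 0 = a at hlq
  generalize m.coeff 0 = b at hlq
  generalize r.coeff 0 = c at hlq
  have hexp : (X + C a) * ((X + C b) * (X + C c)) =
      X ^ 3 + C (a + b + c) * X ^ 2 + C (a * b + b * c + c * a) * X + C (a * b * c) := by
    simp only [C_add, C_mul]
    ring
  rw [hexp] at hlq
  have key : ∀ u v w : ℤ, (X ^ 3 + C u * X ^ 2 + C v * X + C w).coeff 2 = u ∧
      (X ^ 3 + C u * X ^ 2 + C v * X + C w).coeff 1 = v := by
    intro u v w
    simp only [coeff_add, coeff_C_mul, coeff_X, coeff_C, coeff_X_pow]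
    norm_num
  have e2 := (key (a + b + c) (a * b + b * c + c * a) (a * b * c)).1
  have e1 := (key (a + b + c) (a * b + b * c + c * a) (a * b * c)).2
  rw [← hlq, gz_coeff (by norm_num)] at e1 e2
  simp [cf, Nat.ascFactorial, Nat.choose] at e1 e2
  have e3 : (a + b + c) ^ 2 = 9 * (s + 1) ^ 2 := by rw [← e2]; ring
  nlinarith [sq_nonneg (a - b), sq_nonneg (b - c), sq_nonneg (c - a)]

theorem g1_of_gz {n s : ℕ} (h : Irreducible (gz n s) ∨ ∃ l q : ℤ[X], l.Monic ∧ q.Monic ∧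
    l.natDegree = 1 ∧ Irreducible q ∧ gz n s = l * q) :
    Irreducible (g1 n s) ∨
      ∃ l q : ℚ[X], l.natDegree = 1 ∧ Irreducible q ∧ g1 n s = l * q := by
  rw [g1_eq_map]
  rcases h with h | ⟨l, q, hl, hq, hl1, hqi, h⟩
  · exact Or.inl ((IsPrimitive.Int.irreducible_iff_irreducible_map_cast
      (gz_monic n s).isPrimitive).1 h)
  · refine Or.inr ⟨l.map (Int.castRingHom ℚ), q.map (Int.castRingHom ℚ), ?_,
      (IsPrimitive.Int.irreducible_iff_irreducible_map_cast hq.isPrimitive).1 hqi, ?_⟩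
    · rw [hl.natDegree_map, hl1]
    · rw [h, Polynomial.map_mul]

/-- The weighted valuation `d * v_p(P_j) + c * j` of the `j`-th coefficient. -/
noncomputable def wval (p d c : ℕ) (P : ℤ[X]) (j : ℕ) : ℕ :=
  d * padicValInt p (P.coeff j) + c * j

/-- `m` minimizes the weighted valuation; ties are broken by the sign `ε`. -/
def IsVertex (p d c : ℕ) (ε : ℤ) (P : ℤ[X]) (m : ℕ) : Prop :=
  P.coeff m ≠ 0 ∧ ∀ i, P.coeff i ≠ 0 → i ≠ m →
    wval p d c P m < wval p d c P i ∨ (wval p d c P m = wval p d c P i ∧ ε * i < ε * m)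

theorem exists_isVertex (p d c : ℕ) {ε : ℤ} (hε : ε ≠ 0) {P : ℤ[X]} (hP : P ≠ 0) :
    ∃ m, IsVertex p d c ε P m := by
  obtain ⟨m, hm, hmin⟩ := Finset.exists_min_image P.support
    (fun i => toLex ((wval p d c P i : ℤ), -(ε * (i : ℤ)))) (support_nonempty.2 hP)
  refine ⟨m, mem_support_iff.1 hm, fun i hi him => ?_⟩
  have := hmin i (mem_support_iff.2 hi)
  simp only [Prod.Lex.toLex_le_toLex, Nat.cast_lt, Nat.cast_inj] at this
  rcases this with h | ⟨h1, h2⟩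
  · left
    exact h
  · right
    refine ⟨h1, ?_⟩
    refine lt_of_le_of_ne (by linarith) fun h => him ?_
    exact_mod_cast mul_left_cancel₀ hε h

theorem IsVertex.le {p d c : ℕ} {ε : ℤ} {P : ℤ[X]} {m : ℕ} (h : IsVertex p d c ε P m) {i : ℕ}
    (hi : P.coeff i ≠ 0) : wval p d c P m ≤ wval p d c P i := by
  by_cases him : i = m
  · rw [him]
  · rcases h.2 i hi him with h | h
    · exact h.le
    · exact h.1.le

variable {p : ℕ} [hp : Fact p.Prime]

theorem IsVertex.le_wval_mul {d c : ℕ} {ε : ℤ} {g h : ℤ[X]} {m r : ℕ}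
    (hg : IsVertex p d c ε g m) (hh : IsVertex p d c ε h r) {i : ℕ} (hi : (g * h).coeff i ≠ 0) :
    wval p d c g m + wval p d c h r ≤ wval p d c (g * h) i := by
  by_contra! hlt
  have hdvd : (p : ℤ) ^ (padicValInt p ((g * h).coeff i) + 1) ∣ (g * h).coeff i := by
    nth_rewrite 2 [coeff_mul]
    refine Finset.dvd_sum fun x hx => ?_
    rw [HasAntidiagonal.mem_antidiagonal] at hx
    by_cases h0 : g.coeff x.1 * h.coeff x.2 = 0
    · rw [h0]
      exact dvd_zero _
    · have h1 : g.coeff x.1 ≠ 0 := left_ne_zero_of_mul h0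
      have h2 : h.coeff x.2 ≠ 0 := right_ne_zero_of_mul h0
      rw [padicValInt_dvd_iff]
      right
      rw [padicValInt.mul h1 h2]
      have e1 := hg.le h1
      have e2 := hh.le h2
      have : wval p d c g x.1 + wval p d c h x.2 =
        d * (padicValInt p (g.coeff x.1) + padicValInt p (h.coeff x.2)) + c * i := by
        rw [← hx, wval, wval]
        ring
      by_contra! hcon
      have h3 := Nat.mul_le_mul_left d (Nat.lt_succ_iff.1 hcon)
      have h4 : wval p d c (g * h) i = d * padicValInt p ((g * h).coeff i) + c * i := rfl
      omega
  rw [padicValInt_dvd_iff] at hdvd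
  rcases hdvd with h | h
  · exact hi h
  · omega

theorem IsVertex.mul {d c : ℕ} {ε : ℤ} {g h : ℤ[X]} {m r : ℕ}
    (hg : IsVertex p d c ε g m) (hh : IsVertex p d c ε h r) :
    (g * h).coeff (m + r) ≠ 0 ∧
      wval p d c (g * h) (m + r) = wval p d c g m + wval p d c h r := by
  set V := padicValInt p (g.coeff m) + padicValInt p (h.coeff r) with hV
  have hVv : padicValInt p (g.coeff m * h.coeff r) = V := padicValInt.mul hg.1 hh.1
  have hne : g.coeff m * h.coeff r ≠ 0 := mul_ne_zero hg.1 hh.1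
  have hmem : (m, r) ∈ antidiagonal (m + r) := by simp
  have hrest : (p : ℤ) ^ (V + 1) ∣
      ∑ x ∈ (antidiagonal (m + r)).erase (m, r), g.coeff x.1 * h.coeff x.2 := by
    refine Finset.dvd_sum fun x hx => ?_
    rw [mem_erase, HasAntidiagonal.mem_antidiagonal] at hx
    obtain ⟨hxne, hx⟩ := hx
    by_cases h0 : g.coeff x.1 * h.coeff x.2 = 0
    · rw [h0]
      exact dvd_zero _
    · have h1 : g.coeff x.1 ≠ 0 := left_ne_zero_of_mul h0
      have h2 : h.coeff x.2 ≠ 0 := right_ne_zero_of_mul h0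
      have hx1 : x.1 ≠ m := by
        intro h
        apply hxne
        ext
        · exact h
        · simp only
          omega
      have hx2 : x.2 ≠ r := by
        intro h
        omega
      rw [padicValInt_dvd_iff]
      right
      rw [padicValInt.mul h1 h2]
      have hsum : wval p d c g m + wval p d c h r < wval p d c g x.1 + wval p d c h x.2 := by
        rcases hg.2 _ h1 hx1 with e1 | ⟨e1, e1'⟩
        · exact add_lt_add_of_lt_of_le e1 (hh.le h2)
        · rcases hh.2 _ h2 hx2 with e2 | ⟨e2, e2'⟩
          · exact add_lt_add_of_le_of_lt e1.le e2
          · exfalso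
            have : ε * (x.1 + x.2 : ℕ) = ε * (m + r : ℕ) := by rw [hx]
            push_cast at this
            nlinarith
      have e : wval p d c g x.1 + wval p d c h x.2 =
        d * (padicValInt p (g.coeff x.1) + padicValInt p (h.coeff x.2)) + c * (m + r) := by
        rw [← hx, wval, wval]
        ring
      have e' : wval p d c g m + wval p d c h r = d * V + c * (m + r) := by
        rw [wval, wval, hV]
        ring
      rw [e, e'] at hsum
      exact Nat.lt_of_mul_lt_mul_left (a := d) (by omega)
  have hcoeff : (g * h).coeff (m + r) = g.coeff m * h.coeff r +
      ∑ x ∈ (antidiagonal (m + r)).erase (m, r), g.coeff x.1 * h.coeff x.2 := by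
    rw [coeff_mul, ← Finset.add_sum_erase _ _ hmem]
  have hndvd : ¬ (p : ℤ) ^ (V + 1) ∣ (g * h).coeff (m + r) := by
    rw [hcoeff, dvd_add_left hrest, padicValInt_dvd_iff, hVv]
    push Not
    exact ⟨hne, by omega⟩
  have hdvd : (p : ℤ) ^ V ∣ (g * h).coeff (m + r) := by
    rw [hcoeff]
    refine dvd_add ?_ ((pow_dvd_pow _ (Nat.le_succ V)).trans hrest)
    rw [padicValInt_dvd_iff, hVv]
    exact Or.inr le_rfl
  rw [padicValInt_dvd_iff] at hndvd hdvd
  push Not at hndvd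
  refine ⟨hndvd.1, ?_⟩
  have : padicValInt p ((g * h).coeff (m + r)) = V :=
    le_antisymm (Nat.lt_succ_iff.1 hndvd.2) (hdvd.resolve_left hndvd.1)
  rw [wval, this, wval, wval, hV]
  ring

theorem IsVertex.add_le {d c : ℕ} {ε : ℤ} {g h : ℤ[X]} {m r : ℕ}
    (hg : IsVertex p d c ε g m) (hh : IsVertex p d c ε h r) {e : ℕ} (he : (g * h).coeff e ≠ 0)
    (H : ∀ j, (g * h).coeff j ≠ 0 → ε * e < ε * j → wval p d c (g * h) e < wval p d c (g * h) j) :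
    ε * (m + r : ℕ) ≤ ε * e := by
  by_contra! hlt
  obtain ⟨h1, h2⟩ := hg.mul hh
  have h3 := H _ h1 hlt
  have h4 := hg.le_wval_mul hh he
  omega

/-- A Newton polygon criterion excluding monic factors of degree `k`: the slopes of the polygon
between its vertices for the directions `a / b < c / d` have denominators at least `b + d`. -/
theorem natDegree_ne_of_slopes {f g h : ℤ[X]} (hg : g.Monic) (hh : h.Monic) (hf : f = g * h)
    {a b c d k e D : ℕ} (hb : 0 < b) (hd : 0 < d) (hdet : b * c = a * d + 1) (hk : k < b + d)
    (hDn : D ≤ f.natDegree) (he : f.coeff e ≠ 0) (hD : f.coeff D ≠ 0)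
    (heD : e + (f.natDegree - D) < k)
    (He : ∀ j, f.coeff j ≠ 0 → e < j → wval p d c f e < wval p d c f j)
    (HD : ∀ j, f.coeff j ≠ 0 → j < D → wval p b a f D < wval p b a f j) :
    g.natDegree ≠ k := by
  intro hgk
  obtain ⟨m1, hm1⟩ := exists_isVertex p d c (ε := 1) (by norm_num) hg.ne_zero
  obtain ⟨r1, hr1⟩ := exists_isVertex p d c (ε := 1) (by norm_num) hh.ne_zero
  obtain ⟨m0, hm0⟩ := exists_isVertex p b a (ε := -1) (by norm_num) hg.ne_zero
  obtain ⟨r0, hr0⟩ := exists_isVertex p b a (ε := -1) (by norm_num) hh.ne_zero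
  have hdeg : f.natDegree = k + h.natDegree := by rw [hf, hg.natDegree_mul hh, hgk]
  subst hf
  have h1 := hm1.add_le hr1 he (fun j hj hlt => He j hj (by simpa using hlt))
  have h0 := hm0.add_le hr0 hD (fun j hj hlt => HD j hj (by simpa using hlt))
  have hr0' : r0 ≤ h.natDegree := le_natDegree_of_ne_zero hr0.1
  have hm0' : m0 ≤ k := hgk ▸ le_natDegree_of_ne_zero hm0.1
  push_cast at h1 h0
  have hlt : m1 < m0 := by omega
  have k1 : wval p d c g m1 < wval p d c g m0 := by
    rcases hm1.2 m0 hm0.1 (by omega) with h | h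
    · exact h
    · omega
  have k0 : wval p b a g m0 < wval p b a g m1 := by
    rcases hm0.2 m1 hm1.1 (by omega) with h | h
    · exact h
    · omega
  rw [wval, wval] at k0 k1
  zify at k0 k1 hdet hk hm0' hb hd hlt
  nlinarith [mul_le_mul_of_nonneg_left (Int.add_one_le_iff.2 k1) hb.le,
    mul_le_mul_of_nonneg_left (Int.add_one_le_iff.2 k0) hd.le]

theorem noFactor_of_slopes (p : ℕ) [Fact p.Prime] {n s k a b c d e D : ℕ} (hb : 0 < b) (hd : 0 < d)
    (hdet : b * c = a * d + 1) (hk : k < b + d) (he : e ≤ n) (hD : D ≤ n) (heD : e + (n - D) < k)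
    (He : ∀ j ≤ n, e < j → d * padicValNat p (cf n s e) + c * e <
      d * padicValNat p (cf n s j) + c * j)
    (HD : ∀ j < D, b * padicValNat p (cf n s D) + a * D <
      b * padicValNat p (cf n s j) + a * j) : NoFactor n s k := by
  intro g h hg hh hgh
  have hne : ∀ j ≤ n, (gz n s).coeff j ≠ 0 := by
    intro j hj
    rw [gz_coeff hj]
    exact_mod_cast (cf_pos hj).ne'
  have hw : ∀ d c j : ℕ, j ≤ n →
      wval p d c (gz n s) j = d * padicValNat p (cf n s j) + c * j := by
    intro d c j hj
    rw [wval, gz_coeff hj, padicValInt.of_nat]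
  refine natDegree_ne_of_slopes (p := p) hg hh hgh hb hd hdet hk (e := e) (D := D)
    (by rwa [gz_natDegree]) (hne e he) (hne D hD) (by rwa [gz_natDegree]) ?_ ?_
  · intro j hj hej
    have hjn : j ≤ n := by
      rw [← gz_natDegree n s]
      exact le_natDegree_of_ne_zero hj
    rw [hw _ _ _ he, hw _ _ _ hjn]
    exact He j hjn hej
  · intro j hj hjD
    rw [hw _ _ _ hD, hw _ _ _ (by omega)]
    exact HD j hjD

section
variable {p : ℕ} [hp : Fact p.Prime]

theorem mul_add_mul_add_le {k p J F : ℕ} (hkp : k < p) (hJ : 0 < J) (h : (p - 1) * F < J) :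
    k * J + k * F + (p - k) ≤ J * p := by
  obtain ⟨q, rfl⟩ : ∃ q, p = k + 1 + q := ⟨p - (k + 1), by omega⟩
  obtain ⟨I, rfl⟩ : ∃ I, J = I + 1 := ⟨J - 1, by omega⟩
  rw [show k + 1 + q - 1 = k + q by omega] at h
  rw [show k + 1 + q - k = q + 1 by omega]
  nlinarith [Nat.zero_le (I * q), Nat.zero_le (q * F)]

theorem padicValNat_factorial_div (m : ℕ) :
    padicValNat p m.factorial = m / p + padicValNat p (m / p).factorial := by
  rw [← padicValNat_mul_div_factorial, padicValNat_factorial_mul, add_comm]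

theorem padicValNat_factorial_add_le (a b : ℕ) :
    padicValNat p a.factorial + padicValNat p b.factorial ≤ padicValNat p (a + b).factorial := by
  rw [← padicValNat.mul (Nat.factorial_ne_zero a) (Nat.factorial_ne_zero b)]
  exact padicValNat_dvd_iff_le (Nat.factorial_ne_zero _) |>.1
    (pow_padicValNat_dvd.trans (Nat.factorial_mul_factorial_dvd_factorial_add a b))

theorem padicValNat_factorial_mono {a b : ℕ} (h : a ≤ b) :
    padicValNat p a.factorial ≤ padicValNat p b.factorial :=
  padicValNat_dvd_iff_le (Nat.factorial_ne_zero _) |>.1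
    (pow_padicValNat_dvd.trans (Nat.factorial_dvd_factorial h))

theorem padicValNat_choose_add {n j : ℕ} (hj : j ≤ n) :
    padicValNat p (n.choose j) + padicValNat p j.factorial + padicValNat p (n - j).factorial =
      padicValNat p n.factorial := by
  rw [← padicValNat.mul (Nat.choose_pos hj).ne' (Nat.factorial_ne_zero _),
    ← padicValNat.mul (mul_ne_zero (Nat.choose_pos hj).ne' (Nat.factorial_ne_zero _))
      (Nat.factorial_ne_zero _), Nat.choose_mul_factorial_mul_factorial hj]

theorem padicValNat_cf {n j : ℕ} (s : ℕ) (hj : j ≤ n) :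
    padicValNat p (cf n s j) + padicValNat p s.factorial + padicValNat p j.factorial +
      padicValNat p (n - j).factorial =
    padicValNat p n.factorial + padicValNat p (s + (n - j)).factorial := by
  rw [cf, padicValNat.mul (Nat.choose_pos hj).ne' (Nat.ascFactorial_pos _ _).ne',
    ← padicValNat_choose_add hj, ← Nat.factorial_mul_ascFactorial s (n - j),
    padicValNat.mul (Nat.factorial_ne_zero _) (Nat.ascFactorial_pos _ _).ne']
  ring

/-- Irreducibility criterion from a prime `p > k` dividing one of `n, n - 1, …, n - k + 1`. -/
theorem noFactor_of_prime {n s k : ℕ} (hkn : k ≤ n) (hkp : k < p) (ht : n % p < k)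
    (h1 : k * padicValNat p ((n / p + s / p).choose (s / p)) < s % p + n % p + 1)
    (h2 : k * padicValNat p ((n / p + s / p).choose (s / p)) < p - k) : NoFactor n s k := by
  have hp0 : 0 < p := hp.out.pos
  obtain ⟨A, hA⟩ : ∃ A, A = n / p := ⟨_, rfl⟩
  obtain ⟨S, hS⟩ : ∃ S, S = s / p := ⟨_, rfl⟩
  obtain ⟨t, ht'⟩ : ∃ t, t = n % p := ⟨_, rfl⟩
  obtain ⟨σ, hσ⟩ : ∃ σ, σ = s % p := ⟨_, rfl⟩
  have hσp : σ < p := hσ ▸ Nat.mod_lt s hp0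
  have hn : n = A * p + t := by rw [hA, ht', Nat.div_add_mod']
  have hs : s = S * p + σ := by rw [hS, hσ, Nat.div_add_mod']
  set c := padicValNat p ((n / p + s / p).choose (s / p)) with hc
  rw [← hA, ← hS] at hc
  rw [← hσ, ← ht'] at h1
  rw [← ht'] at ht
  have hcF := padicValNat_choose_add (p := p) (Nat.le_add_left S A)
  rw [← hc, Nat.add_sub_cancel] at hcF
  obtain ⟨z, hz⟩ : ∃ z, z = min t (p - 1 - σ) := ⟨_, rfl⟩
  have hdiv : ∀ a b : ℕ, b < p → (a * p + b) / p = a := fun a b hb => by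
    rw [mul_comm, Nat.mul_add_div hp0, Nat.div_eq_of_lt hb, add_zero]
  have hL : ∀ a b : ℕ, b < p → padicValNat p (a * p + b).factorial =
      a + padicValNat p a.factorial := fun a b hb => by
    rw [padicValNat_factorial_div, hdiv a b hb]
  have hzn : z ≤ n := by
    have := Nat.mod_le n p
    omega
  have hFn := hL A t (by omega)
  have hFs := hL S σ hσp
  rw [← hn] at hFn
  rw [← hs] at hFs
  have hvD : padicValNat p (cf n s (n - z)) = 0 := by
    have e1 := padicValNat_cf (p := p) s (Nat.sub_le n z)
    have e2 := hL 0 z (by omega)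
    have e3 := hL A (t - z) (by omega)
    have e4 := hL S (σ + z) (by omega)
    rw [show n - (n - z) = z by omega] at e1
    rw [show A * p + (t - z) = n - z by omega] at e3
    rw [show S * p + (σ + z) = s + z by omega] at e4
    simp only [zero_mul, zero_add, Nat.factorial_zero, padicValNat_one_right] at e2
    omega
  have hve : padicValNat p (cf n s (t - z)) + padicValNat p s.factorial =
      A + S + padicValNat p (A + S).factorial := by
    have e1 := padicValNat_cf (p := p) s (j := t - z) (n := n) (by omega)
    have e2 := hL 0 (t - z) (by omega)
    have e3 := hL A z (by omega)
    have e4 := hL (A + S) (σ + z) (by omega)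
    rw [show A * p + z = n - (t - z) by omega] at e3
    rw [show (A + S) * p + (σ + z) = s + (n - (t - z)) by rw [add_mul]; omega] at e4
    simp only [zero_mul, zero_add, Nat.factorial_zero, padicValNat_one_right] at e2
    omega
  refine noFactor_of_slopes p (a := 0) (b := 1) (c := 1) (d := k) (e := t - z) (D := n - z)
    (by omega) (by omega) (by omega) (by omega) (by omega) (by omega) (by omega) ?_ ?_
  · intro j hj hej
    have e1 := padicValNat_cf (p := p) s hj
    obtain ⟨J, hJ⟩ : ∃ J, J = j / p := ⟨_, rfl⟩
    obtain ⟨j0, hj0⟩ : ∃ j0, j0 = j % p := ⟨_, rfl⟩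
    obtain ⟨B, hB⟩ : ∃ B, B = (n - j) / p := ⟨_, rfl⟩
    obtain ⟨b0, hb0⟩ : ∃ b0, b0 = (n - j) % p := ⟨_, rfl⟩
    have hj0p : j0 < p := hj0 ▸ Nat.mod_lt j hp0
    have hb0p : b0 < p := hb0 ▸ Nat.mod_lt _ hp0
    have hjJ : j = J * p + j0 := by rw [hJ, hj0, Nat.div_add_mod']
    have hnB : n - j = B * p + b0 := by rw [hB, hb0, Nat.div_add_mod']
    have f1 := hL J j0 hj0p
    have f2 := hL B b0 hb0p
    rw [← hjJ] at f1
    rw [← hnB] at f2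
    have hJk : 0 < J → k * J + k * padicValNat p J.factorial + (p - k) ≤ J * p := by
      intro h0
      have h3 := sub_one_mul_padicValNat_factorial_lt_of_ne_zero p h0.ne'
      exact mul_add_mul_add_le hkp h0 h3
    have hsum : A * p + t = (J + B) * p + (j0 + b0) := by
      rw [← hn, add_mul]
      omega
    have hcarry : (A = J + B ∧ j0 + b0 = t) ∨ (A = J + B + 1 ∧ j0 + b0 = p + t) := by
      rcases lt_or_ge (j0 + b0) p with h | h
      · have h3 := hdiv A t (by omega)
        rw [hsum, hdiv _ _ h] at h3
        subst h3
        left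
        omega
      · have h3 := hdiv A t (by omega)
        rw [hsum, show (J + B) * p + (j0 + b0) = (J + B + 1) * p + (j0 + b0 - p) by
          rw [add_mul (J + B), one_mul]; omega, hdiv _ _ (by omega)] at h3
        subst h3
        right
        rw [add_mul (J + B), one_mul] at hsum
        omega
    have hsn : s + (n - j) = (S + B) * p + (σ + b0) := by
      rw [add_mul, hnB]
      omega
    have hcarry' : (σ + b0 < p ∧ padicValNat p (s + (n - j)).factorial =
          S + B + padicValNat p (S + B).factorial) ∨
        (p ≤ σ + b0 ∧ padicValNat p (s + (n - j)).factorial =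
          S + B + 1 + padicValNat p (S + B + 1).factorial) := by
      rcases lt_or_ge (σ + b0) p with h | h
      · left
        rw [hsn, hL _ _ h]
        exact ⟨h, rfl⟩
      · right
        rw [hsn, show (S + B) * p + (σ + b0) = (S + B + 1) * p + (σ + b0 - p) by
          rw [add_mul (S + B), one_mul]; omega, hL _ _ (by omega)]
        exact ⟨h, rfl⟩
    have hSB := padicValNat_factorial_add_le (p := p) S B
    have hSB1 := padicValNat_factorial_mono (p := p) (a := S + B) (b := S + B + 1) (by omega)
    suffices hgoal : k * (A + S + padicValNat p (A + S).factorial) + (t - z) +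
        k * (padicValNat p j.factorial + padicValNat p (n - j).factorial) <
        k * (padicValNat p n.factorial + padicValNat p (s + (n - j)).factorial) + j by
      have h3 := congrArg (k * ·) hve
      have h4 := congrArg (k * ·) e1
      simp only [mul_add] at h3 h4 hgoal ⊢
      omega
    rw [f1, f2, hFn]
    have hcF' := congrArg (k * ·) hcF
    have hSB' := Nat.mul_le_mul_left k hSB
    have hSB1' := Nat.mul_le_mul_left k hSB1
    rcases Nat.eq_zero_or_pos J with h0 | h0
    · subst h0
      rw [zero_add] at hcarry
      rw [zero_mul, zero_add] at hjJ
      rw [Nat.factorial_zero, padicValNat_one_right]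
      rcases hcarry with ⟨h3, h4⟩ | ⟨h3, h4⟩
      · rw [h3, add_comm B S] at hcF' ⊢
        rcases hcarry' with ⟨h5, h6⟩ | ⟨h5, h6⟩
        · rw [h6]
          simp only [mul_add, mul_zero] at hcF' hSB' ⊢
          omega
        · omega
      · rw [h3, show B + 1 + S = S + B + 1 by omega] at hcF' ⊢
        rcases hcarry' with ⟨h5, h6⟩ | ⟨h5, h6⟩
        · rw [h6]
          have hz0 : t - z = 0 := by omega
          rw [hz0]
          simp only [mul_add, mul_one, mul_zero] at hcF' hSB' ⊢
          omega
        · have hB1 := Nat.mul_le_mul_left k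
            (padicValNat_factorial_mono (p := p) (a := B) (b := B + 1) (by omega))
          rw [h6]
          simp only [mul_add, mul_one, mul_zero] at hcF' ⊢
          omega
    · specialize hJk h0
      rcases hcarry with ⟨h3, h4⟩ | ⟨h3, h4⟩ <;> rcases hcarry' with ⟨h5, h6⟩ | ⟨h5, h6⟩ <;>
        rw [h6] <;> subst h3 <;> simp only [mul_add, mul_one] at hcF' hSB' hSB1' ⊢ <;> omega
  · intro j hjD
    have e1 := padicValNat_cf (p := p) s (j := j) (n := n) (by omega)
    obtain ⟨J, hJ⟩ : ∃ J, J = j / p := ⟨_, rfl⟩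
    obtain ⟨j0, hj0⟩ : ∃ j0, j0 = j % p := ⟨_, rfl⟩
    obtain ⟨B, hB⟩ : ∃ B, B = (n - j) / p := ⟨_, rfl⟩
    obtain ⟨b0, hb0⟩ : ∃ b0, b0 = (n - j) % p := ⟨_, rfl⟩
    have hj0p : j0 < p := hj0 ▸ Nat.mod_lt j hp0
    have hb0p : b0 < p := hb0 ▸ Nat.mod_lt _ hp0
    have hjJ : j = J * p + j0 := by rw [hJ, hj0, Nat.div_add_mod']
    have hnB : n - j = B * p + b0 := by rw [hB, hb0, Nat.div_add_mod']
    have f1 := hL J j0 hj0p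
    have f2 := hL B b0 hb0p
    rw [← hjJ] at f1
    rw [← hnB] at f2
    rw [hvD]
    have hsum : A * p + t = (J + B) * p + (j0 + b0) := by
      rw [← hn, add_mul]
      omega
    have hcarry : (A = J + B ∧ j0 + b0 = t) ∨ (A = J + B + 1 ∧ j0 + b0 = p + t) := by
      rcases lt_or_ge (j0 + b0) p with h | h
      · have h3 := hdiv A t (by omega)
        rw [hsum, hdiv _ _ h] at h3
        subst h3
        left
        omega
      · have h3 := hdiv A t (by omega)
        rw [hsum, show (J + B) * p + (j0 + b0) = (J + B + 1) * p + (j0 + b0 - p) by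
          rw [add_mul (J + B), one_mul]; omega, hdiv _ _ (by omega)] at h3
        subst h3
        right
        rw [add_mul (J + B), one_mul] at hsum
        omega
    have hsn : s + (n - j) = (S + B) * p + (σ + b0) := by
      rw [add_mul, hnB]
      omega
    have hcarry' : (σ + b0 < p ∧ padicValNat p (s + (n - j)).factorial =
          S + B + padicValNat p (S + B).factorial) ∨
        (p ≤ σ + b0 ∧ padicValNat p (s + (n - j)).factorial =
          S + B + 1 + padicValNat p (S + B + 1).factorial) := by
      rcases lt_or_ge (σ + b0) p with h | h
      · left
        rw [hsn, hL _ _ h]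
        exact ⟨h, rfl⟩
      · right
        rw [hsn, show (S + B) * p + (σ + b0) = (S + B + 1) * p + (σ + b0 - p) by
          rw [add_mul (S + B), one_mul]; omega, hL _ _ (by omega)]
        exact ⟨h, rfl⟩
    have hSB := padicValNat_factorial_add_le (p := p) S B
    have hSB1 := padicValNat_factorial_mono (p := p) (a := S + B) (b := S + B + 1) (by omega)
    have hJB := padicValNat_factorial_add_le (p := p) J B
    have hJB1 := padicValNat_factorial_mono (p := p) (a := J + B) (b := J + B + 1) (by omega)
    suffices 0 < padicValNat p (cf n s j) by omega
    rcases Nat.eq_zero_or_pos B with h0 | h0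
    · subst h0
      rcases hcarry with ⟨h3, h4⟩ | ⟨h3, h4⟩ <;> rcases hcarry' with ⟨h5, h6⟩ | ⟨h5, h6⟩ <;>
        subst h3 <;> simp only [Nat.add_zero, zero_add, Nat.zero_mul] at h4 h6 e1 f1 f2 hFn hnB hcF hSB hJB hJB1 hSB1 <;> omega
    · rcases hcarry with ⟨h3, h4⟩ | ⟨h3, h4⟩ <;> rcases hcarry' with ⟨h5, h6⟩ | ⟨h5, h6⟩ <;>
        subst h3 <;> omega
end

section
variable {p : ℕ} [hp : Fact p.Prime]

/-- The sum of the base `p` digits of `m`. -/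
def dsum (p m : ℕ) : ℕ := (p.digits m).sum

theorem dsum_add (m : ℕ) : dsum p m + (p - 1) * padicValNat p m.factorial = m := by
  rw [sub_one_mul_padicValNat_factorial, dsum]
  have := Nat.digit_sum_le p m
  omega

theorem dsum_mul_pow_add (M : ℕ) {h r : ℕ} (hr : r < p ^ h) :
    dsum p (M * p ^ h + r) = dsum p M + dsum p r := by
  induction h generalizing r with
  | zero =>
    obtain rfl : r = 0 := by simpa using hr
    simp [dsum]
  | succ h ih =>
    have hp1 : 1 < p := hp.out.one_lt
    have key : ∀ m, dsum p m = m % p + dsum p (m / p) := by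
      intro m
      rcases Nat.eq_zero_or_pos m with h0 | h0
      · simp [h0, dsum]
      · rw [dsum, Nat.digits_def' hp1 h0, List.sum_cons, dsum]
    have hr' : r / p < p ^ h := by
      rw [Nat.div_lt_iff_lt_mul hp.out.pos, ← pow_succ]
      exact hr
    rw [key, key r, show M * p ^ (h + 1) + r = r + p * (M * p ^ h) by ring,
      Nat.add_mul_mod_self_left, Nat.add_mul_div_left _ _ hp.out.pos, add_comm (r / p), ih hr']
    omega

theorem dsum_pos {m : ℕ} (hm : 0 < m) : 0 < dsum p m := by
  have := dsum_add (p := p) m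
  have := sub_one_mul_padicValNat_factorial_lt_of_ne_zero p hm.ne'
  omega

theorem dsum_add_le (a b : ℕ) : dsum p (a + b) ≤ dsum p a + b := by
  have h1 := dsum_add (p := p) a
  have h2 := dsum_add (p := p) (a + b)
  have h3 := Nat.mul_le_mul_left (p - 1) (padicValNat_factorial_mono (p := p) (Nat.le_add_right a b))
  omega

theorem padicValNat_factorial_mul_pow_add (M : ℕ) {h r : ℕ} (hr : r < p ^ h) :
    padicValNat p (M * p ^ h + r).factorial =
      padicValNat p (M * p ^ h).factorial + padicValNat p r.factorial := by
  have h1 := dsum_add (p := p) (M * p ^ h + r)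
  have h2 := dsum_add (p := p) (M * p ^ h)
  have h3 := dsum_add (p := p) r
  have h4 := dsum_mul_pow_add (p := p) M hr
  have h5 := dsum_mul_pow_add (p := p) M (r := 0) (h := h) (pow_pos hp.out.pos h)
  have h6 : dsum p 0 = 0 := by simp [dsum]
  rw [add_zero] at h5
  have hp1 := hp.out.two_le
  refine Nat.eq_of_mul_eq_mul_left (show 0 < p - 1 by omega) ?_
  rw [mul_add]
  omega

/-- The valuation of the binomial coefficient `(x + s).choose s`. -/
def kap (p s x : ℕ) : ℕ := padicValNat p ((x + s).choose s)

theorem kap_add (s x : ℕ) : kap p s x + padicValNat p s.factorial + padicValNat p x.factorial =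
    padicValNat p (x + s).factorial := by
  have := padicValNat_choose_add (p := p) (Nat.le_add_left s x)
  rwa [Nat.add_sub_cancel] at this

theorem kap_mul_pow_add (N : ℕ) {s h x : ℕ} (hx : x + s < p ^ h) :
    kap p s (N * p ^ h + x) = kap p s x := by
  have h1 := kap_add (p := p) s x
  have h2 := kap_add (p := p) s (N * p ^ h + x)
  rw [add_assoc (N * p ^ h), padicValNat_factorial_mul_pow_add N hx,
    padicValNat_factorial_mul_pow_add N (by omega)] at h2
  omega

theorem kap_le {s x y : ℕ}
    (H : ∀ h, p ^ h ≤ s % p ^ h + x % p ^ h → p ^ h ≤ s % p ^ h + y % p ^ h) :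
    kap p s x ≤ kap p s y := by
  set b := max (Nat.log p (x + s)) (Nat.log p (y + s)) + 1
  rw [kap, kap, padicValNat_choose' (b := b) (by omega), padicValNat_choose' (b := b) (by omega)]
  refine Finset.card_le_card fun h hh => ?_
  rw [mem_filter] at hh ⊢
  exact ⟨hh.1, H h hh.2⟩

theorem add_mod_cases (a b P : ℕ) (hP : 0 < P) :
    a % P + b % P = (a + b) % P ∨ a % P + b % P = (a + b) % P + P := by
  have h1 := Nat.mod_lt a hP
  have h2 := Nat.mod_lt b hP
  have h3 := Nat.add_mod a b P
  rcases lt_or_ge (a % P + b % P) P with h | h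
  · rw [Nat.mod_eq_of_lt h] at h3
    exact Or.inl h3.symm
  · have h4 : (a % P + b % P - P) % P = a % P + b % P - P := Nat.mod_eq_of_lt (by omega)
    rw [Nat.mod_eq_sub_mod h, h4] at h3
    omega

theorem exists_kap_le {α t s n j y : ℕ} (hn : n % p ^ α = t) (hst : s + t < p ^ α) (hj : j + y = n)
    (hjt : t < j % p ^ α) :
    ∃ i ≤ t, dsum p i < dsum p (j % p ^ α) ∧ kap p s (t - i) ≤ kap p s y := by
  have hp1 := hp.out.one_lt
  set h := Nat.findGreatest (fun h => j % p ^ h ≤ t % p ^ h) α with hh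
  have hspec : j % p ^ h ≤ t % p ^ h :=
    Nat.findGreatest_spec (P := fun h => j % p ^ h ≤ t % p ^ h) (m := 0) (Nat.zero_le α)
      (by simp only [pow_zero, Nat.mod_one]; exact le_rfl)
  have hle : h ≤ α := Nat.findGreatest_le α
  have hgt : ∀ h', h < h' → h' ≤ α → t % p ^ h' < j % p ^ h' := by
    intro h' h1 h2
    exact not_le.mp (Nat.findGreatest_is_greatest (P := fun h => j % p ^ h ≤ t % p ^ h) h1 h2)
  clear_value h
  have hit : j % p ^ h ≤ t := hspec.trans (Nat.mod_le _ _)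
  have hih : j % p ^ h < p ^ h := Nat.mod_lt _ (pow_pos hp.out.pos h)
  refine ⟨j % p ^ h, hit, ?_, kap_le fun h' hcar => ?_⟩
  · have e1 := Nat.div_add_mod' (j % p ^ α) (p ^ h)
    rw [Nat.mod_mod_of_dvd _ (pow_dvd_pow p hle)] at e1
    rw [← e1, dsum_mul_pow_add _ hih]
    have : 0 < j % p ^ α / p ^ h := by
      rw [Nat.pos_iff_ne_zero]
      intro h0
      rw [h0] at e1
      omega
    have := dsum_pos (p := p) this
    omega
  · have hP : 0 < p ^ h' := pow_pos hp.out.pos h'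
    rcases le_or_gt h' α with h1 | h1
    · have a1 := add_mod_cases j y _ hP
      have a2 := add_mod_cases (j % p ^ h) (t - j % p ^ h) _ hP
      rw [hj] at a1
      rw [Nat.add_sub_cancel' hit] at a2
      have a3 : n % p ^ h' = t % p ^ h' := by
        rw [← hn, Nat.mod_mod_of_dvd _ (pow_dvd_pow p h1)]
      rw [a3] at a1
      have b1 := Nat.mod_lt j hP
      have b2 := Nat.mod_lt y hP
      have b3 := Nat.mod_lt t hP
      have b4 := Nat.mod_lt (t - j % p ^ h) hP
      rcases le_or_gt h' h with h2 | h2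
      · rw [Nat.mod_mod_of_dvd _ (pow_dvd_pow p h2)] at a2
        generalize (t - j % p ^ h) % p ^ h' = A at *
        generalize s % p ^ h' = B at *
        generalize t % p ^ h' = C at *
        generalize j % p ^ h' = D at *
        generalize y % p ^ h' = E at *
        generalize p ^ h' = F at *
        omega
      · have c1 := hgt h' h2 h1
        have c2 : j % p ^ h < p ^ h' := hih.trans_le (Nat.pow_le_pow_right hp1.le h2.le)
        have c3 : j % p ^ h % p ^ h' = j % p ^ h := Nat.mod_eq_of_lt c2
        have c4 : t % p ^ h ≤ t % p ^ h' := by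
          rw [← Nat.mod_mod_of_dvd t (pow_dvd_pow p h2.le)]
          exact Nat.mod_le _ _
        rw [c3] at a2
        generalize (t - j % p ^ h) % p ^ h' = A at *
        generalize s % p ^ h' = B at *
        generalize t % p ^ h' = C at *
        generalize j % p ^ h' = D at *
        generalize y % p ^ h' = E at *
        generalize p ^ h' = F at *
        omega
    · exfalso
      have h3 := Nat.mod_le (t - j % p ^ h) (p ^ h')
      have h4 := Nat.mod_le s (p ^ h')
      have h5 : p ^ α ≤ p ^ h' := Nat.pow_le_pow_right hp1.le h1.le
      generalize (t - j % p ^ h) % p ^ h' = A at *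
      generalize s % p ^ h' = B at *
      have : A ≤ t := h3.trans (Nat.sub_le _ _)
      omega

end

theorem exists_last_min (f : ℕ → ℤ) (t : ℕ) :
    ∃ e ≤ t, (∀ i ≤ t, f e ≤ f i) ∧ ∀ i ≤ t, e < i → f e < f i := by
  induction t with
  | zero =>
    refine ⟨0, le_rfl, fun i hi => ?_, fun i hi h => ?_⟩
    · rw [Nat.le_zero.mp hi]
    · omega
  | succ t ih =>
    obtain ⟨e, he, h1, h2⟩ := ih
    rcases le_or_gt (f (t + 1)) (f e) with h | h
    · refine ⟨t + 1, le_rfl, fun i hi => ?_, fun i hi h => by omega⟩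
      rcases Nat.le_succ_iff.mp hi with h3 | rfl
      · exact h.trans (h1 i h3)
      · exact le_rfl
    · refine ⟨e, by omega, fun i hi => ?_, fun i hi h4 => ?_⟩ <;>
        rcases Nat.le_succ_iff.mp hi with h3 | rfl
      exacts [h1 i h3, h.le, h2 i h3 h4, h]

theorem exists_first_min (f : ℕ → ℤ) (t : ℕ) :
    ∃ e ≤ t, (∀ i ≤ t, f e ≤ f i) ∧ ∀ i < e, f e < f i := by
  obtain ⟨e, he, h1, h2⟩ := exists_last_min (fun i => f (t - i)) t
  refine ⟨t - e, Nat.sub_le _ _, fun i hi => ?_, fun i hi => ?_⟩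
  · have := h1 (t - i) (Nat.sub_le _ _)
    rwa [Nat.sub_sub_self hi] at this
  · have := h2 (t - i) (Nat.sub_le _ _) (by omega)
    rwa [Nat.sub_sub_self (by omega)] at this

section
variable {p : ℕ} [hp : Fact p.Prime]

theorem sub_one_mul_padicValNat_cf {n j : ℕ} (s : ℕ) (hj : j ≤ n) :
    (p - 1) * padicValNat p (cf n s j) + j =
      (p - 1) * padicValNat p n.factorial + (dsum p j + (p - 1) * kap p s (n - j)) := by
  have h1 := padicValNat_cf (p := p) s hj
  have h2 := kap_add (p := p) s (n - j)
  have h3 := dsum_add (p := p) j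
  rw [add_comm (n - j)] at h2
  have h4 : padicValNat p (cf n s j) + padicValNat p j.factorial =
    padicValNat p n.factorial + kap p s (n - j) := by omega
  have h5 := congrArg ((p - 1) * ·) h4
  simp only [mul_add] at h5
  omega

theorem noFactor_of_prime_pow {α t n s k : ℕ} (hn : n % p ^ α = t) (htk : t < k)
    (hkq : k < p ^ α) (hst : s + t < p ^ α) : NoFactor n s k := by
  have hp2 := hp.out.two_le
  set a := (k - 1) / (p - 1) with ha
  have hdm := Nat.div_add_mod (k - 1) (p - 1)
  have hml := Nat.mod_lt (k - 1) (show 0 < p - 1 by omega)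
  rw [← ha] at hdm
  set b := (p - 1) * a + 1 with hb
  have hbk : b ≤ k := by omega
  have hNt := Nat.div_add_mod' n (p ^ α)
  rw [hn] at hNt
  set N := n / p ^ α with hN
  set q := p ^ α with hq
  set Φ : ℕ → ℕ := fun j => dsum p j + (p - 1) * kap p s (n - j) with hΦ
  set Ψ : ℕ → ℕ := fun j => dsum p j + (p - 1) * kap p s (t - j) with hΨ
  have hval : ∀ j ≤ n, (p - 1) * padicValNat p (cf n s j) + j =
      (p - 1) * padicValNat p n.factorial + Φ j := fun j hj => sub_one_mul_padicValNat_cf s hj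
  have hΦΨ : ∀ J ≤ N, ∀ i ≤ t, Φ (J * q + i) = dsum p J + Ψ i := by
    intro J hJ i hi
    have h1 : n - (J * q + i) = (N - J) * q + (t - i) := by
      have := Nat.mul_le_mul_right q hJ
      rw [Nat.sub_mul]
      omega
    simp only [hΦ, hΨ, h1]
    rw [dsum_mul_pow_add J (by omega), kap_mul_pow_add (N - J) (by omega), add_assoc]
  have hΦ0 : ∀ i ≤ t, Φ i = Ψ i := by
    intro i hi
    have := hΦΨ 0 (Nat.zero_le _) i hi
    simpa [dsum] using this
  have hbig : ∀ j ≤ n, t < j % q → ∃ i ≤ t, Ψ i + dsum p (j / q) < Φ j := by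
    intro j hj hjt
    obtain ⟨i, hi, h1, h2⟩ := exists_kap_le (p := p) (α := α) (s := s) hn hst
      (Nat.add_sub_cancel' hj) hjt
    refine ⟨i, hi, ?_⟩
    have h3 := Nat.mul_le_mul_left (p - 1) h2
    have h4 := dsum_mul_pow_add (p := p) (j / q) (Nat.mod_lt j (show 0 < q by omega))
    rw [Nat.div_add_mod' j q] at h4
    simp only [hΦ, hΨ]
    omega
  clear_value Φ Ψ
  obtain ⟨e, het, he1, he2⟩ := exists_last_min (fun i => (Ψ i : ℤ)) t
  obtain ⟨i0, hi0t, hi1, hi2⟩ := exists_first_min (fun i => (b * Ψ i : ℤ) - i) t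
  have hei : e ≤ i0 := by
    by_contra! h
    have h1 := hi1 e het
    have h2 := he1 i0 hi0t
    have h3 : (b : ℤ) * Ψ e ≤ b * Ψ i0 := mul_le_mul_of_nonneg_left h2 (by positivity)
    omega
  refine noFactor_of_slopes p (a := a) (b := b) (c := 1) (d := p - 1) (e := e) (D := N * q + i0)
    (by omega) (by omega) (by rw [hb]; ring) (by omega) (by omega) (by omega) (by omega) ?_ ?_
  · intro j hj hej
    rw [one_mul, one_mul, hval e (by omega), hval j hj, hΦ0 e het]
    refine Nat.add_lt_add_left ?_ _
    rcases le_or_gt (j % q) t with h | h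
    · have h1 := Nat.div_add_mod' j q
      have h2 := hΦΨ (j / q) (Nat.div_le_div_right hj) (j % q) h
      rw [h1] at h2
      rcases Nat.eq_zero_or_pos (j / q) with h0 | h0
      · rw [h0, zero_mul, zero_add] at h1
        rw [h1] at h h2
        have := he2 j h hej
        omega
      · have := dsum_pos (p := p) h0
        have := he1 _ h
        omega
    · obtain ⟨i, hi, h1⟩ := hbig j hj h
      have := he1 _ hi
      omega
  · intro j hjD
    have hjn : j ≤ n := by omega
    suffices hs : b * Φ (N * q + i0) + j < b * Φ j + (N * q + i0) by
      have e1 := hval j hjn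
      have e2 := hval (N * q + i0) (by omega)
      generalize padicValNat p (cf n s j) = x at *
      generalize padicValNat p (cf n s (N * q + i0)) = y at *
      generalize padicValNat p n.factorial = z at *
      have e1' := congrArg (b * ·) e1
      have e2' := congrArg (b * ·) e2
      refine Nat.lt_of_mul_lt_mul_left (a := p - 1) ?_
      generalize p - 1 = r at *
      generalize N * q + i0 = D at *
      have hbj : b * j = r * a * j + j := by rw [hb]; ring
      have hbD : b * D = r * a * D + D := by rw [hb]; ring
      rw [mul_add, mul_add] at e1' e2'
      rw [mul_add, mul_add, ← mul_assoc, ← mul_assoc, ← mul_assoc, ← mul_assoc, mul_comm r b,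
        mul_assoc b, mul_assoc b]
      omega
    rw [hΦΨ N le_rfl i0 hi0t, mul_add]
    have hjN := Nat.div_le_div_right (c := q) hjn
    have h1 := Nat.div_add_mod' j q
    have hmq := Nat.mod_lt j (show 0 < q by omega)
    have hJle : j / q ≤ N := hjN
    obtain ⟨L, hL⟩ := Nat.exists_eq_add_of_le hJle
    have hS : b * dsum p N ≤ b * dsum p (j / q) + b * L := by
      rw [hL, ← mul_add]
      exact Nat.mul_le_mul_left b (dsum_add_le _ _)
    have hNq : N * q = j / q * q + L * q := by rw [hL]; ring
    have hbq : L * b ≤ L * q := Nat.mul_le_mul_left L (by omega)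
    rw [mul_comm L b] at hbq
    rcases le_or_gt (j % q) t with h | h
    · have h2 := hΦΨ (j / q) hjN (j % q) h
      rw [h1] at h2
      rw [h2, mul_add]
      have h3 := hi1 _ h
      rcases Nat.eq_zero_or_pos L with h0 | h0
      · subst h0
        have h4 := hi2 (j % q) (by omega)
        have h5 : b * Ψ i0 + j % q < b * Ψ (j % q) + i0 := by omega
        have : N = j / q := by omega
        rw [← this] at h1 ⊢
        omega
      · have hbq' : L * b < L * q := Nat.mul_lt_mul_of_pos_left (by omega) h0
        rw [mul_comm L b] at hbq'
        have h5 : b * Ψ i0 + j % q ≤ b * Ψ (j % q) + i0 := by omega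
        omega
    · obtain ⟨i, hi, h2⟩ := hbig j hjn h
      have h3 := hi1 i hi
      have h4 : b * (Ψ i + dsum p (j / q) + 1) ≤ b * Φ j := Nat.mul_le_mul_left b h2
      rw [mul_add, mul_add, mul_one] at h4
      rcases Nat.eq_zero_or_pos L with h0 | h0
      · subst h0
        omega
      · obtain ⟨M, rfl⟩ := Nat.exists_eq_add_of_lt h0
        have hbq' : M * b ≤ M * q := Nat.mul_le_mul_left M (by omega)
        have e3 : b * (0 + M + 1) = M * b + b := by ring
        have e4 : (0 + M + 1) * q = M * q + q := by ring
        rw [e3] at hS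
        rw [e4] at hNq
        have h5 : b * Ψ i0 + i ≤ b * Ψ i + i0 := by omega
        omega

end

/-- `f n`, arranged so that `n` is evaluated before it is substituted. -/
def withValue {α : Type} (n : ℕ) (f : ℕ → α) : α :=
  match n with
  | 0 => f 0
  | m + 1 => f (m + 1)

theorem withValue_eq {α : Type} (n : ℕ) (f : ℕ → α) : withValue n f = f n := by
  cases n <;> rfl

def allBelow (f : ℕ → Bool) : ℕ → Bool
  | 0 => true
  | m + 1 => f m && allBelow f m

theorem of_allBelow {f : ℕ → Bool} {n : ℕ} (h : allBelow f n = true) {i : ℕ} (hi : i < n) :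
    f i = true := by
  induction n with
  | zero => omega
  | succ n ih =>
    rw [allBelow, Bool.and_eq_true] at h
    rcases Nat.lt_succ_iff_lt_or_eq.mp hi with h1 | rfl
    · exact ih h.2 h1
    · exact h.1

def vfac (p : ℕ) : ℕ → ℕ → ℕ
  | 0, _ => 0
  | f + 1, m => bif m.blt p then 0 else withValue (m / p) fun m' => m' + vfac p f m'

def vcf (p n s j : ℕ) : ℕ :=
  vfac p n n + vfac p (s + (n - j)) (s + (n - j)) -
    (vfac p s s + vfac p j j + vfac p (n - j) (n - j))

def slopesCheck (n s k p a b c d e D : ℕ) : Bool :=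
  Nat.blt 0 b && Nat.blt 0 d && Nat.beq (b * c) (a * d + 1) && Nat.blt k (b + d) &&
  Nat.ble e n && Nat.ble D n && Nat.blt (e + (n - D)) k &&
  allBelow (fun j =>
    (Nat.ble j e || Nat.blt (d * vcf p n s e + c * e) (d * vcf p n s j + c * j)) &&
    (Nat.ble D j || Nat.blt (b * vcf p n s D + a * D) (b * vcf p n s j + a * j))) (n + 1)

def powersUpTo (p K : ℕ) : ℕ → ℕ → List ℕ
  | 0, q => [q]
  | f + 1, q => q :: bif (p * q).ble K then withValue (p * q) (powersUpTo p K f) else []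

def maxPow (p K : ℕ) : ℕ → ℕ → ℕ
  | 0, q => q
  | f + 1, q => bif (p * q).ble K then withValue (p * q) (maxPow p K f) else q

def primesDesc : List ℕ :=
  [89, 83, 79, 73, 71, 67, 61, 59, 53, 47, 43, 41, 37, 31, 29, 23, 19, 17, 13, 11, 7, 5, 3, 2]

def primeCheck (n s k p : ℕ) : Bool :=
  Nat.blt k p && Nat.blt (n % p) k &&
  withValue (k * (vfac p (n / p + s / p) (n / p + s / p) -
    (vfac p (n / p) (n / p) + vfac p (s / p) (s / p)))) fun c =>
    Nat.blt c (s % p + n % p + 1) && Nat.blt c (p - k)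

def primePowCheck (n s k q : ℕ) : Bool :=
  Nat.blt (n % q) k && Nat.blt k q && Nat.blt (s + n % q) q

def noFactorCheck (n s k : ℕ) : Bool :=
  primesDesc.any fun p => primeCheck n s k p || (powersUpTo p n n 1).any (primePowCheck n s k)

def bnd (al : ℕ → Bool) (K : ℕ) : ℕ :=
  primesDesc.foldr (fun p acc => bif al p then maxPow p K K 1 * acc else acc) 1

def rootSearch (k N : ℕ) : ℕ → ℕ → ℕ
  | 0, r => r
  | b + 1, r => withValue (r + 2 ^ b) fun r' =>
      bif Nat.ble (r' ^ k) N then rootSearch k N b r' else rootSearch k N b r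

def shrink (al : ℕ → ℕ → Bool) (k K X : ℕ) : ℕ :=
  withValue (k.factorial * bnd (al X) K) fun N =>
    withValue (rootSearch k N (N.log2 / k + 1) 0) fun r =>
      bif Nat.blt N ((r + 1) ^ k) then r + k - 1 else X

def shrinkIter (al : ℕ → ℕ → Bool) (k K : ℕ) (f : ℕ → Bool) : ℕ → ℕ → Bool
  | 0, X => f X
  | g + 1, X => withValue (shrink al k K X) fun Y =>
      bif Nat.blt Y X then shrinkIter al k K f g Y else f X

def startBound (k K : ℕ) : ℕ := k.factorial * bnd (fun _ => true) K + k

def allowed (k s X p : ℕ) : Bool :=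
  Nat.ble p k || (Nat.ble p s &&
    Nat.ble (p ^ ((min (s % p + 1) (p - k) + k - 1) / k + 1)) (X + s))

def allDivisors (X : ℕ) (T : ℕ → Bool) : List (List ℕ) → ℕ → Bool
  | [], m => T m
  | o :: l, m => o.all fun q => withValue (m * q) fun m' =>
      Nat.blt (X + 1) m' || allDivisors X T l m'

def slopeData : List (ℕ × ℕ × ℕ × ℕ × ℕ × ℕ × ℕ × ℕ × ℕ × ℕ) := [
  (4, 6, 2, 3, 1, 2, 1, 1, 0, 3), (4, 7, 2, 3, 1, 2, 1, 1, 0, 3), (4, 8, 2, 2, 1, 2, 1, 1, 0, 4),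
  (4, 15, 2, 2, 1, 1, 3, 2, 0, 4), (4, 16, 2, 2, 1, 2, 1, 1, 0, 4), (4, 17, 2, 2, 1, 2, 1, 1, 0, 4),
  (4, 24, 2, 2, 1, 2, 1, 1, 0, 4), (4, 25, 2, 2, 1, 2, 1, 1, 0, 4), (4, 26, 2, 2, 1, 2, 1, 1, 0, 4),
  (4, 33, 2, 2, 1, 2, 1, 1, 0, 4), (4, 34, 2, 2, 1, 2, 1, 1, 0, 4), (4, 35, 2, 2, 1, 2, 1, 1, 0, 4),
  (4, 42, 2, 2, 1, 2, 1, 1, 0, 4), (4, 43, 2, 2, 1, 2, 1, 1, 0, 4), (4, 44, 2, 3, 1, 2, 1, 1, 1, 4),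
  (4, 51, 2, 2, 1, 2, 1, 1, 0, 4), (4, 52, 2, 53, 0, 1, 1, 2, 0, 4), (4, 53, 2, 5, 0, 1, 1, 2, 0, 3),
  (4, 60, 2, 3, 1, 2, 1, 1, 0, 3), (4, 61, 2, 3, 1, 2, 1, 1, 0, 3), (4, 62, 2, 2, 3, 2, 2, 1, 0, 4),
  (4, 69, 2, 3, 1, 2, 1, 1, 0, 3), (4, 70, 2, 3, 1, 2, 1, 1, 0, 3), (4, 71, 2, 3, 1, 2, 1, 1, 1, 4),
  (4, 78, 2, 2, 1, 1, 3, 2, 0, 4), (4, 79, 2, 2, 1, 1, 3, 2, 0, 4), (4, 80, 2, 2, 1, 2, 1, 1, 0, 4),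
  (4, 87, 2, 3, 1, 2, 1, 1, 0, 3), (4, 88, 2, 2, 1, 2, 1, 1, 0, 4), (4, 89, 2, 2, 1, 2, 1, 1, 0, 4),
  (5, 20, 2, 5, 0, 1, 1, 2, 1, 5), (5, 21, 2, 11, 0, 1, 1, 2, 0, 5), (5, 45, 2, 5, 0, 1, 1, 2, 1, 5),
  (5, 46, 2, 2, 1, 1, 3, 2, 0, 4), (5, 70, 2, 5, 0, 1, 1, 2, 1, 5), (5, 71, 2, 3, 1, 2, 1, 1, 0, 5),
  (6, 20, 3, 7, 0, 1, 1, 3, 0, 6), (6, 21, 3, 5, 1, 3, 1, 2, 0, 5), (6, 22, 3, 5, 1, 3, 1, 2, 0, 5),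
  (6, 23, 3, 5, 1, 3, 1, 2, 0, 5), (6, 24, 3, 2, 2, 3, 1, 1, 0, 4), (6, 45, 3, 2, 1, 1, 4, 3, 0, 4),
  (6, 46, 3, 2, 1, 1, 4, 3, 0, 5), (6, 47, 3, 2, 1, 1, 4, 3, 0, 6), (6, 48, 3, 2, 2, 3, 1, 1, 0, 4),
  (6, 49, 3, 2, 2, 3, 1, 1, 0, 4), (6, 70, 2, 71, 0, 1, 1, 2, 0, 6), (6, 70, 3, 71, 0, 1, 1, 3, 0, 6),
  (6, 71, 3, 5, 1, 3, 1, 2, 0, 5), (6, 72, 3, 2, 2, 3, 1, 1, 0, 4), (6, 73, 3, 2, 2, 3, 1, 1, 0, 4),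
  (6, 74, 3, 2, 2, 3, 1, 1, 2, 6), (7, 42, 2, 7, 0, 1, 1, 2, 1, 7), (7, 43, 2, 11, 0, 1, 1, 2, 0, 7),
  (8, 42, 2, 11, 0, 1, 1, 2, 0, 7), (8, 42, 3, 11, 0, 1, 1, 3, 0, 7), (8, 43, 3, 11, 0, 1, 1, 3, 0, 8),
  (8, 45, 4, 5, 1, 3, 1, 2, 0, 5), (8, 46, 4, 5, 1, 3, 1, 2, 0, 5), (8, 47, 4, 5, 1, 3, 1, 2, 1, 6),
  (8, 48, 4, 2, 3, 4, 1, 1, 0, 8), (8, 91, 2, 23, 0, 1, 1, 2, 0, 8), (8, 91, 3, 23, 0, 1, 1, 3, 0, 8),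
  (8, 92, 3, 2, 1, 1, 4, 3, 0, 8), (9, 18, 2, 2, 1, 2, 1, 1, 0, 8), (9, 19, 2, 2, 1, 2, 1, 1, 1, 9),
  (9, 20, 2, 2, 1, 2, 1, 1, 0, 8), (9, 21, 2, 2, 1, 2, 1, 1, 1, 9), (9, 22, 2, 2, 1, 2, 1, 1, 0, 8),
  (9, 23, 2, 2, 1, 2, 1, 1, 1, 9), (9, 24, 2, 3, 1, 2, 1, 1, 0, 9), (9, 25, 2, 3, 1, 2, 1, 1, 0, 9),
  (9, 26, 2, 3, 1, 2, 1, 1, 0, 9), (9, 42, 3, 3, 1, 3, 1, 2, 0, 9), (9, 42, 4, 3, 1, 3, 1, 2, 0, 9),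
  (9, 43, 4, 3, 1, 3, 1, 2, 0, 9), (9, 44, 4, 3, 1, 3, 1, 2, 0, 9), (9, 45, 2, 23, 0, 1, 1, 2, 0, 9),
  (9, 45, 4, 7, 1, 4, 1, 3, 0, 7), (9, 46, 2, 47, 0, 1, 1, 2, 0, 9), (9, 46, 4, 7, 1, 4, 1, 3, 0, 7),
  (9, 47, 4, 7, 1, 4, 1, 3, 1, 8), (9, 48, 2, 2, 1, 2, 1, 1, 0, 8), (9, 48, 4, 2, 3, 4, 1, 1, 0, 8),
  (9, 49, 2, 2, 1, 2, 1, 1, 1, 9), (9, 50, 2, 2, 1, 2, 1, 1, 0, 8), (9, 51, 2, 2, 1, 2, 1, 1, 1, 9),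
  (9, 52, 2, 2, 1, 2, 1, 1, 0, 8), (9, 53, 2, 2, 1, 2, 1, 1, 1, 9), (9, 72, 2, 37, 0, 1, 1, 2, 0, 8),
  (9, 73, 2, 5, 0, 1, 1, 2, 0, 8), (9, 74, 2, 5, 0, 1, 1, 2, 0, 9), (9, 75, 2, 3, 1, 2, 1, 1, 0, 9),
  (9, 76, 2, 3, 1, 2, 1, 1, 0, 9), (9, 77, 2, 3, 1, 2, 1, 1, 0, 9), (9, 78, 2, 3, 1, 2, 1, 1, 0, 9),
  (9, 79, 2, 3, 1, 2, 1, 1, 0, 9), (9, 80, 2, 2, 1, 2, 1, 1, 0, 8), (9, 91, 3, 3, 1, 3, 1, 2, 0, 9),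
  (9, 91, 4, 3, 1, 3, 1, 2, 0, 9), (9, 92, 4, 2, 1, 1, 5, 4, 0, 8), (10, 15, 3, 3, 1, 3, 1, 2, 0, 9),
  (10, 16, 3, 2, 2, 3, 1, 1, 0, 8), (10, 17, 3, 2, 2, 3, 1, 1, 0, 8), (10, 18, 3, 2, 2, 3, 1, 1, 2, 10),
  (10, 19, 3, 2, 2, 3, 1, 1, 2, 10), (10, 20, 2, 5, 0, 1, 1, 2, 0, 10), (10, 20, 3, 2, 2, 3, 1, 1, 0, 8),
  (10, 21, 2, 3, 1, 2, 1, 1, 0, 9), (10, 21, 3, 2, 2, 3, 1, 1, 0, 8), (10, 22, 3, 2, 2, 3, 1, 1, 2, 10),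
  (10, 23, 3, 2, 2, 3, 1, 1, 2, 10), (10, 24, 3, 3, 1, 2, 2, 3, 0, 9), (10, 40, 3, 3, 1, 3, 1, 2, 0, 9),
  (10, 41, 3, 3, 1, 3, 1, 2, 1, 10), (10, 42, 3, 3, 1, 3, 1, 2, 0, 9), (10, 42, 4, 3, 1, 3, 1, 2, 0, 9),
  (10, 42, 5, 3, 2, 5, 1, 2, 0, 9), (10, 43, 3, 3, 1, 3, 1, 2, 0, 9), (10, 43, 4, 3, 1, 3, 1, 2, 0, 9),
  (10, 43, 5, 3, 2, 5, 1, 2, 0, 9), (10, 44, 3, 3, 1, 3, 1, 2, 1, 10), (10, 44, 4, 3, 1, 3, 1, 2, 1, 10),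
  (10, 44, 5, 3, 2, 5, 1, 2, 1, 10), (10, 45, 2, 5, 0, 1, 1, 2, 0, 10), (10, 45, 3, 23, 0, 1, 1, 3, 0, 10),
  (10, 45, 4, 7, 1, 4, 1, 3, 0, 7), (10, 45, 5, 7, 1, 4, 1, 3, 0, 7), (10, 46, 2, 5, 0, 1, 1, 2, 0, 10),
  (10, 46, 3, 5, 0, 1, 1, 3, 0, 10), (10, 46, 4, 5, 1, 4, 1, 3, 0, 10), (10, 46, 5, 5, 1, 4, 1, 3, 0, 10),
  (10, 47, 3, 5, 0, 1, 1, 3, 0, 10), (10, 47, 4, 5, 1, 4, 1, 3, 0, 10), (10, 47, 5, 5, 1, 4, 1, 3, 0, 10),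
  (10, 48, 3, 2, 2, 3, 1, 1, 0, 8), (10, 48, 4, 2, 3, 4, 1, 1, 0, 8), (10, 48, 5, 2, 4, 5, 1, 1, 0, 8),
  (10, 49, 3, 2, 2, 3, 1, 1, 0, 8), (10, 65, 3, 2, 2, 3, 1, 1, 0, 8), (10, 66, 3, 2, 2, 3, 1, 1, 2, 10),
  (10, 67, 3, 2, 2, 3, 1, 1, 2, 10), (10, 68, 3, 2, 2, 3, 1, 1, 0, 8), (10, 69, 3, 2, 2, 3, 1, 1, 0, 8),
  (10, 70, 3, 2, 2, 3, 1, 1, 2, 10), (10, 71, 3, 2, 2, 3, 1, 1, 2, 10), (10, 72, 3, 5, 0, 1, 1, 3, 0, 10),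
  (10, 73, 3, 5, 0, 1, 1, 3, 0, 10), (10, 74, 3, 5, 0, 1, 1, 3, 0, 10), (10, 90, 3, 3, 1, 3, 1, 2, 0, 9),
  (10, 91, 3, 3, 1, 3, 1, 2, 0, 9), (10, 91, 4, 3, 1, 3, 1, 2, 0, 9), (10, 91, 5, 2, 1, 1, 6, 5, 0, 6),
  (10, 92, 3, 2, 1, 1, 4, 3, 0, 8), (10, 92, 4, 2, 1, 1, 5, 4, 0, 8), (10, 92, 5, 2, 1, 1, 6, 5, 0, 8),
  (15, 35, 2, 5, 0, 1, 1, 2, 1, 15), (16, 20, 2, 5, 0, 1, 1, 2, 0, 15), (16, 35, 2, 2, 1, 2, 1, 1, 0, 16),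
  (16, 35, 3, 2, 2, 3, 1, 1, 0, 16), (16, 40, 2, 2, 1, 2, 1, 1, 0, 16), (16, 42, 3, 2, 2, 3, 1, 1, 0, 16),
  (16, 45, 2, 2, 1, 2, 1, 1, 0, 16), (16, 60, 2, 2, 1, 1, 3, 2, 0, 16), (16, 70, 2, 2, 1, 2, 1, 1, 0, 16),
  (16, 85, 2, 29, 0, 1, 1, 2, 0, 15), (16, 91, 3, 5, 0, 1, 1, 3, 0, 15), (21, 35, 2, 2, 1, 2, 1, 1, 1, 21),
  (28, 70, 2, 3, 1, 2, 1, 1, 0, 27), (28, 71, 2, 3, 1, 2, 1, 1, 1, 28), (28, 77, 2, 3, 1, 2, 1, 1, 1, 28),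
  (28, 78, 2, 3, 1, 2, 1, 1, 0, 27), (33, 88, 2, 2, 1, 2, 1, 1, 0, 32), (33, 89, 2, 2, 1, 2, 1, 1, 1, 33),
  (36, 70, 2, 5, 0, 1, 1, 2, 0, 35), (100, 66, 2, 5, 0, 1, 1, 2, 0, 100), (105, 91, 2, 5, 0, 1, 1, 2, 0, 105),
  (225, 35, 2, 5, 0, 1, 1, 2, 0, 225), (225, 70, 2, 5, 0, 1, 1, 2, 0, 225), (225, 91, 2, 5, 0, 1, 1, 2, 0, 225)]

def exceptions : List (ℕ × ℕ × ℕ) :=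
  (9, 47, 2) :: slopeData.map fun x => (x.1, x.2.1, x.2.2.1)

def leafCheck (k s X L n : ℕ) : Bool :=
  Nat.blt n (2 * k) || Nat.blt X n || !allBelow (fun t => Nat.beq (L % (n - t)) 0) k ||
    noFactorCheck n s k ||
    exceptions.any fun x => Nat.beq x.1 n && Nat.beq x.2.1 s && Nat.beq x.2.2 k

def smallCheck (k s : ℕ) : Bool :=
  withValue (max k (s + k - 1)) fun K => 
  withValue (startBound k K) <|
    shrinkIter (allowed k s) k K (fun X => 
      withValue (bnd (allowed k s X) K) fun L =>
        allDivisors X (fun m => (!Nat.beq (L % (m - 1)) 0 || leafCheck k s X L m) &&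
            (!Nat.beq (L % (m + 1)) 0 || leafCheck k s X L (m + 1)))
          (((primesDesc.filter fun p => allowed k s X p && !Nat.beq p 2)).map
            fun p => powersUpTo p (max k (s + 1)) (max k (s + 1)) 1) 1) 20

def allowedMid (k X p : ℕ) : Bool :=
  Nat.ble p k || Nat.ble (p * p) (X + 92)

def midCheck (k : ℕ) : Bool :=
  withValue (k + 91) fun K =>
  withValue (startBound k K) <|
    shrinkIter (allowedMid k) k K (fun X =>
      withValue (bnd (allowedMid k X) K) fun L =>
        allBelow (fun n =>
          Nat.blt n (2 * k) || !allBelow (fun t => Nat.beq (L % (n - t)) 0) k) (X + 1)) 20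

section
variable {p : ℕ} [hp : Fact p.Prime]

theorem vfac_eq {f m : ℕ} (h : m ≤ f) : vfac p f m = padicValNat p m.factorial := by
  induction f generalizing m with
  | zero =>
    obtain rfl : m = 0 := by omega
    simp [vfac]
  | succ f ih =>
    rw [vfac, padicValNat_factorial_div]
    by_cases hm : m < p
    · have h2 : m.blt p = true := Nat.blt_eq.mpr hm
      simp [h2, Nat.div_eq_of_lt hm]
    · have h1 : m / p < m := Nat.div_lt_self (by have := hp.out.pos; omega) hp.out.one_lt
      have h2 : m.blt p = false := by
        rw [Bool.eq_false_iff]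
        simpa using hm
      rw [h2, withValue_eq, cond_false, ih (by omega)]

theorem vcf_eq {n j : ℕ} (s : ℕ) (hj : j ≤ n) : vcf p n s j = padicValNat p (cf n s j) := by
  have := padicValNat_cf (p := p) s hj
  rw [vcf, vfac_eq le_rfl, vfac_eq le_rfl, vfac_eq le_rfl, vfac_eq le_rfl, vfac_eq le_rfl]
  omega

theorem noFactor_of_slopesCheck {n s k a b c d e D : ℕ}
    (h : slopesCheck n s k p a b c d e D = true) : NoFactor n s k := by
  simp only [slopesCheck, Bool.and_eq_true, Nat.blt_eq, Nat.ble_eq, Nat.beq_eq] at h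
  obtain ⟨⟨⟨⟨⟨⟨⟨hb, hd⟩, hdet⟩, hk⟩, he⟩, hD⟩, heD⟩, H⟩ := h
  have H' : ∀ j ≤ n, (j ≤ e ∨ d * vcf p n s e + c * e < d * vcf p n s j + c * j) ∧
      (D ≤ j ∨ b * vcf p n s D + a * D < b * vcf p n s j + a * j) := by
    intro j hj
    simpa using of_allBelow H (Nat.lt_succ_of_le hj)
  refine noFactor_of_slopes p hb hd hdet hk he hD heD (fun j hj hej => ?_) fun j hj => ?_
  · rw [← vcf_eq s he, ← vcf_eq s hj]
    exact (H' j hj).1.resolve_left (by omega)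
  · rw [← vcf_eq s hD, ← vcf_eq s (by omega)]
    exact (H' j (by omega)).2.resolve_left (by omega)

theorem noFactor_of_primeCheck {n s k : ℕ} (hkn : k ≤ n) (h : primeCheck n s k p = true) :
    NoFactor n s k := by
  simp only [primeCheck, Bool.and_eq_true, Nat.blt_eq, withValue_eq, vfac_eq le_rfl] at h
  obtain ⟨⟨h1, h2⟩, h3, h4⟩ := h
  have h5 := padicValNat_choose_add (p := p) (Nat.le_add_left (s / p) (n / p))
  rw [Nat.add_sub_cancel] at h5
  have h6 : padicValNat p ((n / p + s / p).choose (s / p)) =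
      padicValNat p (n / p + s / p).factorial -
        (padicValNat p (n / p).factorial + padicValNat p (s / p).factorial) := by omega
  rw [← h6] at h3 h4
  exact noFactor_of_prime hkn h1 h2 (by omega) h4

omit hp in
theorem exists_pow_of_mem_powersUpTo {K f i q : ℕ} (h : q ∈ powersUpTo p K f (p ^ i)) :
    ∃ j, q = p ^ j := by
  induction f generalizing i with
  | zero => exact ⟨i, by simpa [powersUpTo] using h⟩
  | succ f ih =>
    rw [powersUpTo, List.mem_cons] at h
    rcases h with h | h
    · exact ⟨i, h⟩
    · rw [withValue_eq, ← pow_succ'] at h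
      cases hc : (p ^ (i + 1)).ble K with
      | true =>
        rw [hc] at h
        exact ih h
      | false =>
        rw [hc] at h
        simp at h

theorem pow_mem_powersUpTo {K f i v : ℕ} (hv : p ^ v ≤ K) (hi : i ≤ v) (hf : v ≤ i + f) :
    p ^ v ∈ powersUpTo p K f (p ^ i) := by
  induction f generalizing i with
  | zero =>
    obtain rfl : v = i := by omega
    simp [powersUpTo]
  | succ f ih =>
    rw [powersUpTo, List.mem_cons, withValue_eq, ← pow_succ']
    rcases hi.eq_or_lt with rfl | hlt
    · exact Or.inl rfl
    · right
      have : (p ^ (i + 1)).ble K = true :=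
        Nat.ble_eq.mpr ((Nat.pow_le_pow_right hp.out.pos hlt).trans hv)
      rw [this, cond_true]
      exact ih hlt (by omega)

theorem pow_dvd_maxPow_of_le {K f i v : ℕ} (hv : p ^ v ≤ K) (hf : v ≤ i + f) :
    p ^ v ∣ maxPow p K f (p ^ i) := by
  induction f generalizing i with
  | zero => exact pow_dvd_pow p (by omega)
  | succ f ih =>
    rw [maxPow, withValue_eq, ← pow_succ']
    cases hc : (p ^ (i + 1)).ble K with
    | true =>
      rw [cond_true]
      exact ih (by omega)
    | false =>
      rw [cond_false]
      refine pow_dvd_pow p (Nat.lt_succ_iff.mp ?_)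
      by_contra! h
      have := (Nat.pow_le_pow_right hp.out.pos h).trans hv
      rw [← Nat.ble_eq, hc] at this
      exact absurd this (by simp)

theorem pow_dvd_maxPow {K v : ℕ} (hv : p ^ v ≤ K) : p ^ v ∣ maxPow p K K 1 := by
  refine pow_dvd_maxPow_of_le (i := 0) hv ?_
  have := Nat.lt_pow_self hp.out.one_lt (n := v)
  omega

end

theorem prime_of_mem_primesDesc {p : ℕ} (h : p ∈ primesDesc) : p.Prime := by
  simp only [primesDesc, List.mem_cons, List.not_mem_nil, or_false] at h
  rcases h with rfl | rfl | rfl | rfl | rfl | rfl | rfl | rfl | rfl | rfl | rfl | rfl | rfl | rfl |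
    rfl | rfl | rfl | rfl | rfl | rfl | rfl | rfl | rfl | rfl <;> norm_num

theorem mem_primesDesc {p : ℕ} (hp : p.Prime) (h : p ≤ 92) : p ∈ primesDesc := by
  have key : ∀ q ≤ 92, q ∈ primesDesc ∨ q < 2 ∨ ∃ d ∈ ([2, 3, 5, 7] : List ℕ), d ∣ q ∧ d < q := by
    decide +kernel
  rcases key p h with h1 | h1 | ⟨d, hd, h1, h2⟩
  · exact h1
  · exact absurd hp.two_le (by omega)
  · rcases (Nat.dvd_prime hp).mp h1 with rfl | rfl
    · simp at hd
    · omega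

theorem noFactor_of_noFactorCheck {n s k : ℕ} (hkn : k ≤ n) (h : noFactorCheck n s k = true) :
    NoFactor n s k := by
  rw [noFactorCheck, List.any_eq_true] at h
  obtain ⟨p, hp, h⟩ := h
  have := Fact.mk (prime_of_mem_primesDesc hp)
  rcases Bool.or_eq_true_iff.mp h with h | h
  · exact noFactor_of_primeCheck hkn h
  · obtain ⟨q, hq, h⟩ := List.any_eq_true.mp h
    obtain ⟨j, rfl⟩ := exists_pow_of_mem_powersUpTo (i := 0) hq
    simp only [primePowCheck, Bool.and_eq_true, Nat.blt_eq] at h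
    exact noFactor_of_prime_pow rfl h.1.1 h.1.2 h.2

theorem dvd_bnd {m K : ℕ} {al : ℕ → Bool}
    (h : ∀ p v : ℕ, p.Prime → 0 < v → p ^ v ∣ m → p ≤ 92 ∧ al p = true ∧ p ^ v ≤ K) :
    m ∣ bnd al K := by
  rw [Nat.dvd_iff_prime_pow_dvd_dvd]
  intro p v hp hv
  rcases Nat.eq_zero_or_pos v with rfl | hv0
  · simp
  obtain ⟨h1, h2, h3⟩ := h p v hp hv0 hv
  have := Fact.mk hp
  refine (pow_dvd_maxPow h3).trans ?_
  have key : ∀ l : List ℕ, p ∈ l → maxPow p K K 1 ∣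
      l.foldr (fun p acc => bif al p then maxPow p K K 1 * acc else acc) 1 := by
    intro l
    induction l with
    | nil => simp
    | cons q l ih =>
      intro hl
      rw [List.foldr_cons]
      rcases List.mem_cons.mp hl with rfl | hl
      · rw [h2, cond_true]
        exact dvd_mul_right _ _
      · cases al q
        · exact ih hl
        · exact (ih hl).mul_left _
  exact key _ (mem_primesDesc hp h1)

theorem bnd_pos (al : ℕ → Bool) (K : ℕ) : 0 < bnd al K := by
  by_contra h
  have h0 : bnd al K = 0 := by omega
  have key : ∀ l : List ℕ, (∀ p ∈ l, 0 < p) →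
      0 < l.foldr (fun p acc => bif al p then maxPow p K K 1 * acc else acc) 1 := by
    intro l
    induction l with
    | nil => simp
    | cons q l ih =>
      intro hl
      have h1 := ih fun p hp => hl p (List.mem_cons_of_mem _ hp)
      rw [List.foldr_cons]
      have hm : ∀ f i, 0 < i → 0 < maxPow q K f i := by
        intro f
        induction f with
        | zero => exact fun i hi => hi
        | succ f ih =>
          intro i hi
          rw [maxPow, withValue_eq]
          have := Nat.mul_pos (hl q List.mem_cons_self) hi
          cases (q * i).ble K
          exacts [hi, ih _ this]
      cases al q
      exacts [h1, Nat.mul_pos (hm _ _ one_pos) h1]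
  exact h (key _ fun p hp => (prime_of_mem_primesDesc hp).pos)

section
variable {p : ℕ} [hp : Fact p.Prime] {n s k : ℕ}

theorem pow_le_of_not_noFactor (hN : ¬ NoFactor n s k) {t v : ℕ} (htk : t < k) (htn : t ≤ n)
    (h : p ^ v ∣ n - t) : p ^ v ≤ max k (s + t) := by
  by_contra! hlt
  rw [max_lt_iff] at hlt
  refine hN (noFactor_of_prime_pow (p := p) (α := v) (t := t) ?_ htk hlt.1 hlt.2)
  obtain ⟨c, hc⟩ := h
  rw [show n = t + p ^ v * c by omega, Nat.add_mul_mod_self_left, Nat.mod_eq_of_lt (by omega)]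

theorem pow_padicValNat_choose_le {a b : ℕ} (h : 0 < a) :
    p ^ padicValNat p (a.choose b) ≤ a := by
  refine (Nat.pow_le_pow_right hp.out.pos ?_).trans (Nat.pow_log_le_self p h.ne')
  rw [← Nat.factorization_def _ hp.out]
  exact Nat.factorization_choose_le_log

theorem exists_of_not_noFactor (hN : ¬ NoFactor n s k) {t : ℕ} (hkn : k ≤ n) (htk : t < k)
    (hkp : k < p) (h : p ∣ n - t) :
    ∃ c, 0 < c ∧ min (s % p + 1) (p - k) ≤ k * c ∧ p ≤ s ∧ p ^ (c + 1) ≤ n + s := by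
  have hnt : n % p = t := by
    obtain ⟨c, hc⟩ := h
    rw [show n = t + p * c by omega, Nat.add_mul_mod_self_left, Nat.mod_eq_of_lt (by omega)]
  obtain ⟨c, hc⟩ : ∃ c, c = padicValNat p ((n / p + s / p).choose (s / p)) := ⟨_, rfl⟩
  have h1 : min (s % p + 1) (p - k) ≤ k * c := by
    by_contra! h1
    exact hN (noFactor_of_prime (p := p) hkn hkp (by omega) (by rw [← hc]; omega)
      (by rw [← hc]; omega))
  have hc0 : 0 < c := by
    rcases Nat.eq_zero_or_pos c with h0 | h0
    · rw [h0] at h1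
      omega
    · exact h0
  have hps : p ≤ s := by
    by_contra! hps
    rw [Nat.div_eq_of_lt hps, Nat.choose_zero_right] at hc
    simp at hc
    omega
  have hsp : 0 < s / p := Nat.div_pos hps hp.out.pos
  refine ⟨c, hc0, h1, hps, ?_⟩
  have h2 := pow_padicValNat_choose_le (p := p) (b := s / p) (Nat.add_pos_right (n / p) hsp)
  rw [← hc] at h2
  have h3 := Nat.mul_le_mul_left p h2
  rw [mul_add] at h3
  have h4 := Nat.mul_div_le n p
  have h5 := Nat.mul_div_le s p
  rw [pow_succ']
  omega

theorem allowed_of_not_noFactor (hN : ¬ NoFactor n s k) {t X : ℕ} (hk : 0 < k) (hkn : k ≤ n)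
    (htk : t < k) (hnX : n ≤ X) (h : p ∣ n - t) : allowed k s X p = true := by
  simp only [allowed, Bool.or_eq_true, Bool.and_eq_true, Nat.ble_eq]
  rcases le_or_gt p k with hkp | hkp
  · exact Or.inl hkp
  · obtain ⟨c, -, h1, h2, h3⟩ := exists_of_not_noFactor hN hkn htk hkp h
    refine Or.inr ⟨h2, (Nat.pow_le_pow_right hp.out.pos ?_).trans (h3.trans (by omega))⟩
    refine Nat.succ_le_succ (Nat.lt_succ_iff.mp ((Nat.div_lt_iff_lt_mul hk).mpr ?_))
    rw [Nat.succ_mul, mul_comm c]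
    omega

theorem allowedMid_of_not_noFactor (hN : ¬ NoFactor n s k) {t X : ℕ} (hs : s ≤ 92)
    (hkn : k ≤ n) (htk : t < k) (hnX : n ≤ X) (h : p ∣ n - t) : allowedMid k X p = true := by
  simp only [allowedMid, Bool.or_eq_true, Nat.ble_eq]
  rcases le_or_gt p k with hkp | hkp
  · exact Or.inl hkp
  · obtain ⟨c, h1, -, h2, h3⟩ := exists_of_not_noFactor hN hkn htk hkp h
    have := Nat.pow_le_pow_right hp.out.pos (show 2 ≤ c + 1 by omega)
    right
    rw [← sq]
    omega

theorem le_of_not_noFactor (hN : ¬ NoFactor n s k) {t : ℕ} (hkn : k ≤ n) (htk : t < k)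
    (h : p ∣ n - t) : p ≤ max k s := by
  rcases le_or_gt p k with hkp | hkp
  · exact le_max_of_le_left hkp
  · obtain ⟨c, -, -, h2, -⟩ := exists_of_not_noFactor hN hkn htk hkp h
    exact le_max_of_le_right h2

theorem exists_pow_dvd_sub_of_pow_dvd_choose {v : ℕ} (hv : 0 < v) (hkn : k ≤ n)
    (h : p ^ v ∣ n.choose k) : ∃ t < k, ∃ h, v ≤ h ∧ p ^ h ∣ n - t := by
  have h1 : v ≤ padicValNat p (n.choose k) :=
    (padicValNat_dvd_iff_le (Nat.choose_pos hkn).ne').mp h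
  have h2 := padicValNat_choose (p := p) hkn (Nat.lt_succ_self (Nat.log p n))
  rw [h2] at h1
  set S := {i ∈ Finset.Ico 1 (Nat.log p n).succ | p ^ i ≤ k % p ^ i + (n - k) % p ^ i} with hS
  obtain ⟨i, hi, hvi⟩ : ∃ i ∈ S, v ≤ i := by
    by_contra! hcon
    have : S ⊆ Finset.Ico 1 v := fun i hi => by
      have h3 := hcon i hi
      rw [hS, Finset.mem_filter, Finset.mem_Ico] at hi
      exact Finset.mem_Ico.mpr ⟨hi.1.1, h3⟩
    have := Finset.card_le_card this
    rw [Nat.card_Ico] at this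
    omega
  rw [hS, Finset.mem_filter] at hi
  have hP : 0 < p ^ i := pow_pos hp.out.pos i
  have h3 := add_mod_cases k (n - k) (p ^ i) hP
  rw [show k + (n - k) = n by omega] at h3
  have h4 := Nat.mod_lt n hP
  have h5 := Nat.mod_lt (n - k) hP
  have h6 := Nat.mod_le k (p ^ i)
  exact ⟨n % p ^ i, by omega, i, hvi, Nat.dvd_sub_mod n⟩

end

theorem pow_le_factorial_mul_choose (n k : ℕ) :
    (n + 1 - k) ^ k ≤ k.factorial * n.choose k := by
  rw [← Nat.descFactorial_eq_factorial_mul_choose]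
  exact Nat.pow_sub_le_descFactorial n k

theorem shrink_spec {al : ℕ → ℕ → Bool} {n k K X : ℕ} (hnX : n ≤ X)
    (h : n.choose k ∣ bnd (al X) K) : n ≤ shrink al k K X := by
  rw [shrink, withValue_eq, withValue_eq]
  set N := k.factorial * bnd (al X) K with hN
  set r := rootSearch k N (N.log2 / k + 1) 0
  cases hb : Nat.blt N ((r + 1) ^ k) with
  | false => exact hnX
  | true =>
    rw [Nat.blt_eq] at hb
    have h1 := (pow_le_factorial_mul_choose n k).trans
      (Nat.mul_le_mul_left k.factorial (Nat.le_of_dvd (bnd_pos _ _) h))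
    have h2 := lt_of_pow_lt_pow_left₀ k (Nat.zero_le _) (h1.trans_lt hb)
    rw [cond_true]
    omega

theorem shrinkIter_spec {al : ℕ → ℕ → Bool} {n k K : ℕ}
    (h : ∀ X, n ≤ X → n.choose k ∣ bnd (al X) K) {f : ℕ → Bool} {g X : ℕ} (hnX : n ≤ X)
    (hf : shrinkIter al k K f g X = true) : ∃ Y, n ≤ Y ∧ f Y = true := by
  induction g generalizing X with
  | zero => exact ⟨X, hnX, hf⟩
  | succ g ih =>
    rw [shrinkIter, withValue_eq] at hf
    cases hb : Nat.blt (shrink al k K X) X with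
    | false =>
      rw [hb] at hf
      exact ⟨X, hnX, hf⟩
    | true =>
      rw [hb] at hf
      exact ih (shrink_spec hnX (h X hnX)) hf

theorem le_startBound {n k K : ℕ} (hk : 0 < k)
    (h : n.choose k ∣ bnd (fun _ => true) K) : n ≤ startBound k K := by
  have h1 := (pow_le_factorial_mul_choose n k).trans
    (Nat.mul_le_mul_left k.factorial (Nat.le_of_dvd (bnd_pos _ _) h))
  have h2 := Nat.le_self_pow hk.ne' (n + 1 - k)
  rw [startBound]
  omega

theorem allDivisors_spec {X : ℕ} {T : ℕ → Bool} {ps : List ℕ} {opt : ℕ → List ℕ} {e : ℕ → ℕ}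
    {m c : ℕ} (hps : ∀ p ∈ ps, 0 < p) (ho : ∀ p ∈ ps, p ^ e p ∈ opt p)
    (hm : c * (ps.map fun p => p ^ e p).prod = m) (hmX : m ≤ X + 1) (hc : 0 < c)
    (h : allDivisors X T (ps.map opt) c = true) : T m = true := by
  induction ps generalizing c with
  | nil => simpa [allDivisors, ← hm] using h
  | cons p ps ih =>
    rw [List.map_cons, allDivisors, List.all_eq_true] at h
    have h1 := h _ (ho p List.mem_cons_self)
    rw [List.map_cons, List.prod_cons, ← mul_assoc] at hm
    rw [withValue_eq, Bool.or_eq_true, Nat.blt_eq] at h1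
    have hpos : 0 < (ps.map fun p => p ^ e p).prod :=
      List.prod_pos fun a ha => by
        obtain ⟨q, hq, rfl⟩ := List.mem_map.mp ha
        exact pow_pos (hps q (List.mem_cons_of_mem _ hq)) _
    have h2 : c * p ^ e p ≤ m := hm ▸ Nat.le_mul_of_pos_right _ hpos
    exact ih (fun q hq => hps q (List.mem_cons_of_mem _ hq))
      (fun q hq => ho q (List.mem_cons_of_mem _ hq)) hm
      (Nat.mul_pos hc (pow_pos (hps p List.mem_cons_self) _)) (h1.resolve_left (by omega))

theorem allBelow_of {f : ℕ → Bool} {n : ℕ} (h : ∀ i < n, f i = true) : allBelow f n = true := by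
  induction n with
  | zero => rfl
  | succ n ih =>
    rw [allBelow, h n n.lt_succ_self, ih fun i hi => h i (hi.trans n.lt_succ_self)]
    rfl

section
variable {n s k K : ℕ} {al : ℕ → Bool}

theorem choose_dvd_bnd (hN : ¬ NoFactor n s k) (hs : s ≤ 92) (hk : k ≤ 92) (hkn : k ≤ n)
    (hK : max k (s + (k - 1)) ≤ K)
    (hal : ∀ p t : ℕ, p.Prime → t < k → p ∣ n - t → al p = true) : n.choose k ∣ bnd al K := by
  refine dvd_bnd fun p v hp hv h => ?_
  have := Fact.mk hp
  obtain ⟨t, ht, i, hvi, hi⟩ := exists_pow_dvd_sub_of_pow_dvd_choose hv hkn h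
  have hpi : p ∣ n - t := (dvd_pow_self p (by omega)).trans hi
  refine ⟨(le_of_not_noFactor hN hkn ht hpi).trans (max_le hk hs), hal p t hp ht hpi, ?_⟩
  have h1 := Nat.pow_le_pow_right hp.pos hvi
  have h2 := pow_le_of_not_noFactor hN ht (by omega) hi
  omega

theorem sub_dvd_bnd (hN : ¬ NoFactor n s k) (hs : s ≤ 92) (hk : k ≤ 92) (hkn : k ≤ n)
    (hK : max k (s + (k - 1)) ≤ K)
    (hal : ∀ p t : ℕ, p.Prime → t < k → p ∣ n - t → al p = true) {t : ℕ} (ht : t < k) :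
    n - t ∣ bnd al K := by
  refine dvd_bnd fun p v hp hv h => ?_
  have := Fact.mk hp
  have hpi : p ∣ n - t := (dvd_pow_self p (by omega)).trans h
  refine ⟨(le_of_not_noFactor hN hkn ht hpi).trans (max_le hk hs), hal p t hp ht hpi, ?_⟩
  have h2 := pow_le_of_not_noFactor hN ht (by omega) h
  omega

end

theorem noFactor_of_midCheck {n s k : ℕ} (hs : s ≤ 92) (hk0 : 2 ≤ k) (hk : k ≤ 92)
    (hkn : 2 * k ≤ n) (h : midCheck k = true) : NoFactor n s k := by
  by_contra hN
  have hK : max k (s + (k - 1)) ≤ k + 91 := by omega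
  have hkn' : k ≤ n := by omega
  have hal : ∀ X, n ≤ X → ∀ p t : ℕ, p.Prime → t < k → p ∣ n - t → allowedMid k X p = true :=
    fun X hX p t hp ht hpt =>
      have := Fact.mk hp
      allowedMid_of_not_noFactor hN hs hkn' ht hX hpt
  rw [midCheck, withValue_eq, withValue_eq] at h
  obtain ⟨X, hnX, hX⟩ := shrinkIter_spec
    (fun X hX => choose_dvd_bnd hN hs hk hkn' hK (hal X hX))
    (le_startBound (by omega) (choose_dvd_bnd hN hs hk hkn' hK fun _ _ _ _ _ => rfl)) h
  rw [withValue_eq] at hX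
  have h1 := of_allBelow hX (Nat.lt_succ_of_le hnX)
  rw [Bool.or_eq_true, Nat.blt_eq, Bool.not_eq_true', ← Bool.not_eq_true] at h1
  refine h1.elim (by omega) fun h2 => h2 (allBelow_of fun t ht => ?_)
  rw [Nat.beq_eq]
  exact Nat.mod_eq_zero_of_dvd (sub_dvd_bnd hN hs hk hkn' hK (hal X hnX) ht)

theorem prod_map_pow_factorization {m : ℕ} (hm : m ≠ 0) {l : List ℕ} (hl : l.Nodup)
    (h : ∀ p, p.Prime → p ∣ m → p ∈ l) : (l.map fun p => p ^ m.factorization p).prod = m := by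
  rw [← List.prod_toFinset _ hl]
  conv_rhs => rw [← Nat.prod_factorization_pow_eq_self hm]
  rw [Nat.prod_factorization_eq_prod_primeFactors]
  symm
  refine Finset.prod_subset (fun p hp => ?_) fun p _ hp => ?_
  · rw [Nat.mem_primeFactors] at hp
    exact List.mem_toFinset.mpr (h p hp.1 hp.2.1)
  · rw [← Nat.support_factorization, Finsupp.notMem_support_iff] at hp
    rw [hp, pow_zero]

theorem noFactor_of_smallCheck {n s k : ℕ} (hs : s ≤ 92) (hk0 : 2 ≤ k) (hk : k ≤ 92)
    (hkn : 2 * k ≤ n) (hex : ∀ x ∈ exceptions, NoFactor x.1 x.2.1 x.2.2)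
    (h : smallCheck k s = true) : NoFactor n s k := by
  by_contra hN
  have hK : max k (s + (k - 1)) ≤ max k (s + k - 1) := by omega
  have hkn' : k ≤ n := by omega
  have hal : ∀ X, n ≤ X → ∀ p t : ℕ, p.Prime → t < k → p ∣ n - t → allowed k s X p = true :=
    fun X hX p t hp ht hpt =>
      have := Fact.mk hp
      allowed_of_not_noFactor hN (by omega) hkn' ht hX hpt
  rw [smallCheck, withValue_eq, withValue_eq] at h
  obtain ⟨X, hnX, hX⟩ := shrinkIter_spec
    (fun X hX => choose_dvd_bnd hN hs hk hkn' hK (hal X hX))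
    (le_startBound (by omega) (choose_dvd_bnd hN hs hk hkn' hK fun _ _ _ _ _ => rfl)) h
  rw [withValue_eq] at hX
  set L := bnd (allowed k s X) (max k (s + k - 1)) with hL
  have hdvd : ∀ t < k, n - t ∣ L := fun t ht => sub_dvd_bnd hN hs hk hkn' hK (hal X hnX) ht
  have hleaf : leafCheck k s X L n = false := by
    rw [← Bool.not_eq_true]
    intro hleaf
    simp only [leafCheck, Bool.or_eq_true, Nat.blt_eq, Bool.not_eq_true', List.any_eq_true,
      Bool.and_eq_true, Nat.beq_eq] at hleaf
    rcases hleaf with (((h1 | h1) | h1) | h1) | ⟨x, hx, ⟨h1, h2⟩, h3⟩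
    · omega
    · omega
    · rw [← Bool.not_eq_true] at h1
      refine h1 (allBelow_of fun t ht => ?_)
      rw [Nat.beq_eq]
      exact Nat.mod_eq_zero_of_dvd (hdvd t ht)
    · exact hN (noFactor_of_noFactorCheck hkn' h1)
    · have := hex x hx
      rw [h1, h2, h3] at this
      exact hN this
  obtain ⟨t, ht, m, hm, hodd⟩ : ∃ t ≤ 1, ∃ m, m = n - t ∧ m % 2 = 1 := by
    rcases Nat.mod_two_eq_zero_or_one n with h0 | h0
    · exact ⟨1, le_rfl, n - 1, rfl, by omega⟩
    · exact ⟨0, by omega, n, rfl, h0⟩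
  set T : ℕ → Bool := fun m => (!Nat.beq (L % (m - 1)) 0 || leafCheck k s X L m) &&
    (!Nat.beq (L % (m + 1)) 0 || leafCheck k s X L (m + 1)) with hT
  have hTm : T m = true := by
    refine allDivisors_spec (e := m.factorization) (fun p hp => ?_) (fun p hp => ?_)
      ((one_mul _).trans (prod_map_pow_factorization (by omega) ?_ fun p hp hpm => ?_))
      (by omega) one_pos hX
    · exact (prime_of_mem_primesDesc (List.mem_filter.mp hp).1).pos
    · have hp' := prime_of_mem_primesDesc (List.mem_filter.mp hp).1
      have := Fact.mk hp'
      have h1 : p ^ m.factorization p ∣ n - t := hm ▸ Nat.ordProj_dvd m p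
      have h2 := pow_le_of_not_noFactor hN (by omega) (by omega) h1
      have h3 := Nat.lt_pow_self hp'.one_lt (n := m.factorization p)
      exact pow_mem_powersUpTo (i := 0) (by omega) (Nat.zero_le _) (by omega)
    · exact List.Nodup.filter _ (by decide)
    · have := Fact.mk hp
      have h1 : p ∣ n - t := hm ▸ hpm
      rw [List.mem_filter, Bool.and_eq_true]
      refine ⟨mem_primesDesc hp ((le_of_not_noFactor hN hkn' (by omega) h1).trans
        (max_le hk hs)), hal X hnX p t hp (by omega) h1, ?_⟩
      rw [Bool.not_eq_true', ← Bool.not_eq_true, Nat.beq_eq]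
      rintro rfl
      omega
  simp only [hT, Bool.and_eq_true, Bool.or_eq_true, Bool.not_eq_true'] at hTm
  have hL0 : ∀ t < k, (L % (n - t)).beq 0 = true := fun t ht => by
    rw [Nat.beq_eq]
    exact Nat.mod_eq_zero_of_dvd (hdvd t ht)
  interval_cases t
  · rw [show m = n from hm, hL0 1 (by omega), hleaf] at hTm
    simp at hTm
  · rw [show m + 1 = n by omega, show (L % n).beq 0 = true from hL0 0 (by omega), hleaf] at hTm
    simp at hTm

/-- Runs the division of a polynomial over `ZMod 19`, given by its lower coefficients in decreasing
order, by `X ^ 2 + u * X + v`, and tests whether the remainder vanishes. -/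
def quadraticDvd (u v : ZMod 19) : List (ZMod 19) → ZMod 19 → ZMod 19 → Bool
  | [], x, y => decide (x = 0) && decide (y = 0)
  | c :: l, x, y => quadraticDvd u v l (c - u * x - v * y) x

theorem not_quadraticDvd : ∀ u v : ZMod 19, quadraticDvd u v
    ([8, 7, 6, 5, 4, 3, 2, 1, 0].map fun j => (cf 9 47 j : ZMod 19)) 1 0 = false := by
  decide +kernel

theorem noFactor_nine_fortySeven_two : NoFactor 9 47 2 := by
  intro g h hg hh hgh hdeg
  have hdh : h.natDegree = 7 := by
    have := congrArg natDegree hgh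
    rw [gz_natDegree, hg.natDegree_mul hh] at this
    omega
  have hg2 : g.coeff 2 = 1 := hdeg ▸ hg.coeff_natDegree
  have hh7 : h.coeff 7 = 1 := hdh ▸ hh.coeff_natDegree
  have hgz : ∀ i, 2 < i → g.coeff i = 0 := fun i hi => coeff_eq_zero_of_natDegree_lt (by omega)
  have hhz : ∀ i, 7 < i → h.coeff i = 0 := fun i hi => coeff_eq_zero_of_natDegree_lt (by omega)
  have key : ∀ j ≤ 9, (cf 9 47 j : ZMod 19) =
      ∑ x ∈ antidiagonal j, (g.coeff x.1 : ZMod 19) * (h.coeff x.2 : ZMod 19) := by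
    intro j hj
    have h1 := gz_coeff (n := 9) (s := 47) hj
    rw [hgh, coeff_mul] at h1
    have := congrArg (Int.cast : ℤ → ZMod 19) h1
    push_cast at this
    exact this.symm
  set u : ZMod 19 := ((g.coeff 1 : ℤ) : ZMod 19) with hu
  set v : ZMod 19 := ((g.coeff 0 : ℤ) : ZMod 19) with hv
  have step : ∀ j ≤ 7, (cf 9 47 (j + 2) : ZMod 19) - u * h.coeff (j + 1) - v * h.coeff (j + 2) =
      h.coeff j := by
    intro j hj
    rw [key (j + 2) (by omega), Finset.Nat.sum_antidiagonal_eq_sum_range_succ_mk,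
      Finset.sum_range_succ', Finset.sum_range_succ', Finset.sum_range_succ']
    rw [Finset.sum_eq_zero fun i _ => by rw [hgz _ (by omega)]; simp]
    simp [hg2, hu, hv]
    ring
  have s1 : (cf 9 47 1 : ZMod 19) - u * h.coeff 0 - v * h.coeff 1 = 0 := by
    rw [key 1 (by norm_num)]
    simp [Finset.Nat.sum_antidiagonal_eq_sum_range_succ_mk, Finset.sum_range_succ, hu, hv]
  have s0 : (cf 9 47 0 : ZMod 19) - v * h.coeff 0 = 0 := by
    rw [key 0 (by norm_num)]
    simp [hv]
  have h8 := hhz 8 (by norm_num)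
  have := not_quadraticDvd u v
  have t6 := step 6 (by norm_num)
  have t5 := step 5 (by norm_num)
  have t4 := step 4 (by norm_num)
  have t3 := step 3 (by norm_num)
  have t2 := step 2 (by norm_num)
  have t1 := step 1 (by norm_num)
  have t0 := step 0 (by norm_num)
  simp only [hh7, h8, Int.cast_one, Int.cast_zero] at t6 t5 t4 t3 t2 t1 t0
  simp only [List.map_cons, List.map_nil, quadraticDvd] at this
  rw [t6, t5, t4, t3, t2, t1, t0, s1, mul_zero, sub_zero, s0] at this
  simp at this

theorem noFactor_of_mem_exceptions : ∀ x ∈ exceptions, NoFactor x.1 x.2.1 x.2.2 := by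
  intro x hx
  rw [exceptions, List.mem_cons, List.mem_map] at hx
  rcases hx with rfl | ⟨⟨n, s, k, p, a, b, c, d, e, D⟩, hy, rfl⟩
  · exact noFactor_nine_fortySeven_two
  · have key : slopeData.all (fun (n, s, k, p, a, b, c, d, e, D) =>
        primesDesc.contains p && slopesCheck n s k p a b c d e D) = true := by decide +kernel
    have := List.all_eq_true.mp key _ hy
    rw [Bool.and_eq_true, List.contains_iff_mem] at this
    have hp := Fact.mk (prime_of_mem_primesDesc this.1)
    exact noFactor_of_slopesCheck this.2

set_option maxHeartbeats 0 in
set_option maxRecDepth 100000 in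
theorem smallCheck_eq_true {k s : ℕ} (hk : 2 ≤ k) (hk' : k ≤ 12) (hs : s ≤ 92) :
    smallCheck k s = true := by
  refine of_allBelow (f := smallCheck k) (n := 93) ?_ (by omega)
  interval_cases k <;> decide +kernel

set_option maxHeartbeats 0 in
set_option maxRecDepth 100000 in
theorem midCheck_eq_true {k : ℕ} (hk : 13 ≤ k) (hk' : k ≤ 91) : midCheck k = true := by
  interval_cases k <;> decide +kernel

theorem noFactor_of_le {n s k : ℕ} (hs : s ≤ 92) (hk : 2 ≤ k) (hk' : k ≤ 91) (hkn : 2 * k ≤ n) :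
    NoFactor n s k := by
  rcases le_or_gt k 12 with h | h
  · exact noFactor_of_smallCheck hs hk (by omega) hkn noFactor_of_mem_exceptions
      (smallCheck_eq_true hk h hs)
  · exact noFactor_of_midCheck hs hk (by omega) hkn (midCheck_eq_true h hk')

theorem le_four_pow_mul_pow_sqrt {m M K : ℕ} (hm : m ≠ 0) (hK : 0 < K)
    (h : ∀ p ∈ m.primeFactors, p ≤ M ∧ p ^ m.factorization p ≤ K) :
    m ≤ 4 ^ M * K ^ K.sqrt := by
  have h1 : m = ∏ p ∈ m.primeFactors, p ^ m.factorization p := by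
    rw [← Nat.prod_factorization_eq_prod_primeFactors fun p v => p ^ v]
    exact (Nat.prod_factorization_pow_eq_self hm).symm
  rw [← Finset.prod_filter_mul_prod_filter_not _ (fun p => K.sqrt < p)] at h1
  rw [h1]
  refine Nat.mul_le_mul ((Finset.prod_le_prod' (g := fun p => p) fun p hp => ?_).trans
    ((Finset.prod_le_prod_of_subset_of_one_le' (fun p hp => ?_) fun p hp _ => ?_).trans
      (primorial_le_four_pow M))) ((Finset.prod_le_pow_card _ _ K fun p hp => ?_).trans ?_)
  · rw [Finset.mem_filter] at hp
    have h2 := Nat.prime_of_mem_primeFactors hp.1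
    have h3 : m.factorization p ≤ 1 := by
      by_contra! h3
      have h4 := (Nat.pow_le_pow_right h2.pos h3).trans (h p hp.1).2
      exact absurd (Nat.le_sqrt'.mpr h4) (by omega)
    exact (Nat.pow_le_pow_right h2.pos h3).trans (pow_one p).le
  · rw [Finset.mem_filter] at hp
    rw [Finset.mem_filter, Finset.mem_range]
    exact ⟨Nat.lt_succ_of_le (h p hp.1).1, Nat.prime_of_mem_primeFactors hp.1⟩
  · rw [Finset.mem_filter] at hp
    exact hp.2.one_le
  · exact (h p (Finset.mem_filter.mp hp).1).2
  · refine Nat.pow_le_pow_right hK ?_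
    refine (Finset.card_le_card (t := Finset.Icc 1 K.sqrt) fun p hp => ?_).trans (by simp)
    rw [Finset.mem_filter] at hp
    exact Finset.mem_Icc.mpr ⟨(Nat.prime_of_mem_primeFactors hp.1).one_le, not_lt.mp hp.2⟩

section
variable {n s k : ℕ}

theorem choose_le_of_not_noFactor (hN : ¬ NoFactor n s k) (hs : s ≤ 92) (hk : 92 ≤ k)
    (hkn : 2 * k ≤ n) {M : ℕ} (hM : ∀ p : ℕ, p.Prime → p ≤ k → p ∣ n.choose k → p ≤ M) :
    n.choose k ≤ 4 ^ M * (k + 91) ^ (k + 91).sqrt := by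
  refine le_four_pow_mul_pow_sqrt (Nat.choose_pos (by omega)).ne' (by omega) fun p hp => ?_
  rw [Nat.mem_primeFactors] at hp
  have := Fact.mk hp.1
  have hv : 0 < (n.choose k).factorization p := hp.1.factorization_pos_of_dvd hp.2.2 hp.2.1
  obtain ⟨t, ht, i, hvi, hi⟩ := exists_pow_dvd_sub_of_pow_dvd_choose (p := p) hv (by omega)
    (Nat.ordProj_dvd _ _)
  have h1 := le_of_not_noFactor hN (by omega) ht ((dvd_pow_self p (by omega)).trans hi)
  have h2 := pow_le_of_not_noFactor hN ht (by omega) hi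
  have h3 := Nat.pow_le_pow_right hp.1.pos hvi
  exact ⟨hM p hp.1 (by omega) hp.2.1, by omega⟩

theorem prime_le_of_dvd_choose {p : ℕ} (hp : p.Prime) (hpk : p ≤ k) (hkn : 2 * k ≤ n) (h2 : 5 < n)
    (h : p ∣ n.choose k) : p ≤ n / 3 := by
  by_contra! hlt
  have h1 : 0 < (n.choose k).factorization p :=
    hp.factorization_pos_of_dvd (Nat.choose_pos (by omega)).ne' h
  rw [Nat.factorization_choose_of_lt_three_mul (by omega) hpk (by omega) (by omega)] at h1
  exact h1.false

end

theorem ten_pow_le_choose {n k : ℕ} (h : 10 * k ≤ n) : 10 ^ k ≤ n.choose k := by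
  induction k generalizing n with
  | zero => simp
  | succ k ih =>
    obtain ⟨m, rfl⟩ : ∃ m, n = m + 1 := ⟨n - 1, by omega⟩
    have h1 := ih (n := m) (by omega)
    have h2 := Nat.add_one_mul_choose_eq m k
    refine Nat.le_of_mul_le_mul_right (c := k + 1) ?_ k.succ_pos
    rw [← h2, pow_succ, mul_assoc, mul_comm]
    exact Nat.mul_le_mul h h1

theorem five_pow_mul_choose_le {k i : ℕ} (h : 2 * i ≤ k) :
    5 ^ i * (2 * k).choose k ≤ 3 ^ i * (2 * k + i).choose k := by
  induction i with
  | zero => simp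
  | succ i ih =>
    have h1 := ih (by omega)
    have h2 := Nat.choose_mul_succ_eq (2 * k + i) k
    rw [show 2 * k + i + 1 - k = k + i + 1 by omega] at h2
    refine Nat.le_of_mul_le_mul_right (c := k + i + 1) ?_ (Nat.succ_pos _)
    rw [← add_assoc (2 * k) i 1, mul_assoc (3 ^ (i + 1)), ← h2]
    calc 5 ^ (i + 1) * (2 * k).choose k * (k + i + 1)
        = (5 ^ i * (2 * k).choose k) * (5 * (k + i + 1)) := by ring
      _ ≤ (3 ^ i * (2 * k + i).choose k) * (3 * (2 * k + i + 1)) :=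
          Nat.mul_le_mul h1 (by omega)
      _ = 3 ^ (i + 1) * ((2 * k + i).choose k * (2 * k + i + 1)) := by ring

theorem four_pow_le_choose {k : ℕ} (hk : 0 < k) : 4 ^ k ≤ 2 * k * (2 * k).choose k :=
  Nat.four_pow_le_two_mul_self_mul_centralBinom k hk

theorem succ_pow_eight_le {w : ℕ} (hw : 44 ≤ w) : (w + 1) ^ 8 ≤ 2 ^ w := by
  induction w, hw using Nat.le_induction with
  | base => norm_num
  | succ w hw ih =>
    have h1 : 13 * (w + 1 + 1) ≤ 14 * (w + 1) := by omega
    have h2 := Nat.pow_le_pow_left h1 8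
    rw [mul_pow, mul_pow] at h2
    rw [pow_succ 2 w]
    generalize (w + 1 + 1) ^ 8 = A at h2 ⊢
    generalize (w + 1) ^ 8 = B at h2 ih
    omega

theorem pow_sqrt_pow_four_le {K : ℕ} (hK : 1936 ≤ K) : (K ^ K.sqrt) ^ 4 ≤ 2 ^ K := by
  have h1 : 44 ≤ K.sqrt := Nat.le_sqrt'.mpr (by omega)
  have h2 := Nat.sqrt_le' K
  have h3 := (Nat.lt_succ_sqrt' K).le
  calc (K ^ K.sqrt) ^ 4 ≤ (((K.sqrt + 1) ^ 2) ^ K.sqrt) ^ 4 := 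
        Nat.pow_le_pow_left (Nat.pow_le_pow_left h3 _) 4
    _ = ((K.sqrt + 1) ^ 8) ^ K.sqrt := by simp only [← pow_mul]; congr 1; ring
    _ ≤ (2 ^ K.sqrt) ^ K.sqrt := Nat.pow_le_pow_left (succ_pow_eight_le h1) _
    _ = 2 ^ (K.sqrt ^ 2) := by rw [← pow_mul, sq]
    _ ≤ 2 ^ K := Nat.pow_le_pow_right two_pos h2

theorem pow_twelve_lt {k : ℕ} (hk : 2000 ≤ k) : (2 * k) ^ 12 * 2 ^ 273 < 2 ^ k := by
  induction k, hk using Nat.le_induction with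
  | base => decide +kernel
  | succ k hk ih =>
    have h1 : 100 * (2 * (k + 1)) ≤ 101 * (2 * k) := by omega
    have h2 := Nat.pow_le_pow_left h1 12
    rw [mul_pow, mul_pow 101] at h2
    have h4 : (2 * (k + 1)) ^ 12 ≤ 2 * (2 * k) ^ 12 := by
      generalize (2 * (k + 1)) ^ 12 = A at h2 ⊢
      generalize (2 * k) ^ 12 = B at h2 ⊢
      omega
    calc (2 * (k + 1)) ^ 12 * 2 ^ 273 ≤ 2 * (2 * k) ^ 12 * 2 ^ 273 := Nat.mul_le_mul_right _ h4
      _ = 2 * ((2 * k) ^ 12 * 2 ^ 273) := mul_assoc _ _ _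
      _ < 2 * 2 ^ k := Nat.mul_lt_mul_of_pos_left ih two_pos
      _ = 2 ^ (k + 1) := (pow_succ' 2 k).symm

theorem pow_four_mul_lt {i : ℕ} (hi : 1000 ≤ i) :
    2 ^ 92 * (4 * i + 2) ^ 4 * 324 ^ i < 625 ^ i := by
  induction i, hi using Nat.le_induction with
  | base => decide +kernel
  | succ i hi ih =>
    have h1 : 10 * (4 * (i + 1) + 2) ≤ 11 * (4 * i + 2) := by omega
    have h2 := Nat.pow_le_pow_left h1 4
    rw [mul_pow, mul_pow 11] at h2
    have h4 : (4 * (i + 1) + 2) ^ 4 * 324 ≤ 625 * (4 * i + 2) ^ 4 := by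
      generalize (4 * (i + 1) + 2) ^ 4 = A at h2 ⊢
      generalize (4 * i + 2) ^ 4 = B at h2 ⊢
      omega
    calc 2 ^ 92 * (4 * (i + 1) + 2) ^ 4 * 324 ^ (i + 1)
        = (4 * (i + 1) + 2) ^ 4 * 324 * (2 ^ 92 * 324 ^ i) := by ring
      _ ≤ 625 * (4 * i + 2) ^ 4 * (2 ^ 92 * 324 ^ i) := Nat.mul_le_mul_right _ h4
      _ = 625 * (2 ^ 92 * (4 * i + 2) ^ 4 * 324 ^ i) := by ring
      _ < 625 * 625 ^ i := Nat.mul_lt_mul_of_pos_left ih (by norm_num)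
      _ = 625 ^ (i + 1) := (pow_succ' 625 i).symm

theorem four_pow_mul_pow_sqrt_lt {k : ℕ} (hk : 92 ≤ k) (hk' : k < 2000) :
    4 ^ k * (k + 91) ^ (k + 91).sqrt < 10 ^ k := by
  have h1 := Nat.sqrt_le' (k + 91)
  have h2 := (Nat.lt_succ_sqrt' (k + 91)).le
  set w := (k + 91).sqrt
  have key : ∀ w < 46, 2 ^ (max 92 (w ^ 2 - 91)) * ((w + 1) ^ 2) ^ w < 5 ^ (max 92 (w ^ 2 - 91)) := by
    decide +kernel
  have hw : w < 46 := lt_of_pow_lt_pow_left₀ 2 (Nat.zero_le _) (by omega)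
  have h3 := key w hw
  obtain ⟨r, hr⟩ : ∃ r, k = max 92 (w ^ 2 - 91) + r := ⟨k - max 92 (w ^ 2 - 91), by omega⟩
  generalize max 92 (w ^ 2 - 91) = k₀ at h3 hr
  calc 4 ^ k * (k + 91) ^ w ≤ 4 ^ k * ((w + 1) ^ 2) ^ w :=
        Nat.mul_le_mul_left _ (Nat.pow_le_pow_left h2 w)
    _ = 2 ^ k * 2 ^ r * (2 ^ k₀ * ((w + 1) ^ 2) ^ w) := by
        rw [hr, show 4 = 2 * 2 from rfl, mul_pow, pow_add]; ring
    _ < 2 ^ k * 2 ^ r * 5 ^ k₀ := Nat.mul_lt_mul_of_pos_left h3 (by positivity)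
    _ ≤ 2 ^ k * 5 ^ r * 5 ^ k₀ := by gcongr; norm_num
    _ = 10 ^ k := by rw [show 10 = 2 * 5 from rfl, mul_pow 2 5 k, mul_assoc, ← pow_add, hr, add_comm r]

def trialDivision (p : ℕ) : Bool :=
  Nat.blt 1 p && Nat.blt p 20736 && allBelow (fun d => Nat.blt d 2 || Nat.blt 0 (p % d)) 144


theorem prime_of_trialDivision {p : ℕ} (h : trialDivision p = true) : p.Prime := by
  simp only [trialDivision, Bool.and_eq_true, Nat.blt_eq] at h
  obtain ⟨⟨h1, h2⟩, h3⟩ := h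
  by_contra hp
  have h4 := Nat.minFac_sq_le_self (by omega) hp
  have h5 : p.minFac < 144 := lt_of_pow_lt_pow_left₀ 2 (Nat.zero_le _) (by omega)
  have h6 := of_allBelow h3 h5
  rw [Bool.or_eq_true, Nat.blt_eq, Nat.blt_eq, Nat.mod_eq_zero_of_dvd p.minFac_dvd] at h6
  have := (Nat.minFac_prime (n := p) (by omega)).two_le
  omega

def coversUpTo (N : ℕ) : ℕ → List ℕ → Bool
  | a, [] => Nat.ble N (a + 92)
  | a, b :: l => Nat.ble b (a + 92) && trialDivision b && coversUpTo N b l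

theorem exists_prime_of_coversUpTo {N a n : ℕ} {l : List ℕ} (ha : a.Prime)
    (h : coversUpTo N a l = true) (han : a ≤ n) (hn : n < N) :
    ∃ p, p.Prime ∧ p ≤ n ∧ n < p + 92 := by
  induction l generalizing a with
  | nil =>
    rw [coversUpTo, Nat.ble_eq] at h
    exact ⟨a, ha, han, by omega⟩
  | cons b l ih =>
    simp only [coversUpTo, Bool.and_eq_true, Nat.ble_eq] at h
    rcases le_or_gt b n with hb | hb
    · exact ih (prime_of_trialDivision h.1.2) h.2 hb
    · exact ⟨a, ha, han, by omega⟩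

def primeChain : List ℕ :=
  [181, 271, 359, 449, 523, 613, 701, 787, 877, 967, 1051, 1129, 1217, 1307, 1381, 1471, 1559,
  1637, 1723, 1811, 1901, 1987, 2069, 2153, 2243, 2333, 2423, 2503, 2593, 2683, 2767, 2857, 2939,
  3023, 3109, 3191, 3271, 3361, 3449, 3539, 3623, 3709, 3797, 3881, 3967, 4057, 4139, 4229, 4297,
  4373, 4463, 4549, 4639, 4729, 4817, 4903, 4993, 5081, 5171, 5261, 5351, 5441, 5531, 5591, 5669,
  5749, 5839, 5927, 6011, 6101, 6173, 6263, 6353, 6427, 6491, 6581, 6661, 6737, 6827, 6917, 7001,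
  7079, 7159, 7247, 7333, 7417, 7507, 7591, 7681, 7759, 7841, 7927, 8017, 8101, 8191, 8273, 8363,
  8447, 8537, 8627, 8713, 8803, 8893, 8971, 9059, 9137, 9227, 9311, 9397, 9479, 9551, 9631, 9721,
  9811, 9901, 9973, 10061, 10151, 10223, 10313, 10399, 10487, 10567, 10657, 10739, 10799, 10889,
  10979, 11069, 11159, 11243, 11329, 11411, 11497, 11587, 11677, 11743, 11833, 11923, 12011,
  12101, 12163, 12253, 12343, 12433, 12517, 12601, 12689, 12763, 12853, 12941, 13009, 13099,
  13187, 13267, 13339, 13421, 13499, 13577, 13649, 13729, 13807, 13883, 13967, 14057, 14143,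
  14221, 14303, 14389, 14479, 14563, 14653, 14741, 14831, 14897, 14983, 15073, 15161, 15241,
  15331, 15413, 15497, 15583, 15671, 15761, 15823, 15913, 16001, 16091, 16141, 16231, 16319,
  16381, 16453, 16529, 16619, 16703, 16787, 16871, 16943, 17033, 17123, 17209, 17299, 17389,
  17477, 17551, 17627, 17713, 17791, 17881, 17971, 18061, 18149, 18233, 18313, 18401, 18481,
  18553, 18637, 18719, 18803, 18869, 18959, 19037, 19121, 19211, 19301, 19391, 19477, 19559,
  19609, 19699, 19777, 19867, 19949, 20029]
theorem exists_prime_near {n : ℕ} (h : 181 ≤ n) (h' : n < 20000) :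
    ∃ p, p.Prime ∧ p ≤ n ∧ n < p + 92 :=
  exists_prime_of_coversUpTo (N := 20000) (l := primeChain) (by norm_num) (by decide +kernel) h h'

theorem noFactor_of_ge {n s k : ℕ} (hs : s ≤ 92) (hk : 92 ≤ k) (hkn : 2 * k ≤ n) :
    NoFactor n s k := by
  by_contra hN
  rcases lt_or_ge n 20000 with hn | hn
  · obtain ⟨p, hp, h1, h2⟩ := exists_prime_near (by omega) hn
    have := Fact.mk hp
    have h3 := le_of_not_noFactor (p := p) hN (t := n - p) (by omega) (by omega)
      (by rw [Nat.sub_sub_self h1])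
    omega
  have hC := choose_le_of_not_noFactor hN hs hk hkn (M := k) fun _ _ h _ => h
  rcases lt_or_ge k 2000 with hk2 | hk2
  · have h1 := four_pow_mul_pow_sqrt_lt hk hk2
    have h2 := ten_pow_le_choose (show 10 * k ≤ n by omega)
    omega
  have hw := pow_sqrt_pow_four_le (show 1936 ≤ k + 91 by omega)
  have hC' := choose_le_of_not_noFactor (M := n / 3) hN hs hk hkn fun p hp hpk h =>
    prime_le_of_dvd_choose hp hpk hkn (by omega) h
  generalize (k + 91) ^ (k + 91).sqrt = W at hC hC' hw
  have h4 := four_pow_le_choose (show 0 < k by omega)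
  rcases le_or_gt (5 * k) (2 * n) with h5 | h5
  · obtain ⟨i, hi⟩ : ∃ i, i = k / 2 := ⟨_, rfl⟩
    have h1 := five_pow_mul_choose_le (k := k) (i := i) (by omega)
    have h2 : (2 * k + i).choose k ≤ 4 ^ k * W := (Nat.choose_le_choose k (by omega)).trans hC
    have h3 : 5 ^ i ≤ 2 * k * 3 ^ i * W := by
      refine Nat.le_of_mul_le_mul_right (c := 4 ^ k) ?_ (by positivity)
      calc 5 ^ i * 4 ^ k ≤ 5 ^ i * (2 * k * (2 * k).choose k) := Nat.mul_le_mul_left _ h4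
        _ = 2 * k * (5 ^ i * (2 * k).choose k) := by ring
        _ ≤ 2 * k * (3 ^ i * (4 ^ k * W)) :=
          Nat.mul_le_mul_left _ (h1.trans (Nat.mul_le_mul_left _ h2))
        _ = 2 * k * 3 ^ i * W * 4 ^ k := by ring
    have h6 := pow_four_mul_lt (i := i) (by omega)
    refine absurd h6 (not_lt.mpr ?_)
    calc 625 ^ i = (5 ^ i) ^ 4 := by rw [← pow_mul, mul_comm, pow_mul]; norm_num
      _ ≤ (2 * k * 3 ^ i * W) ^ 4 := Nat.pow_le_pow_left h3 4
      _ = (2 * k) ^ 4 * 81 ^ i * W ^ 4 := by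
        rw [mul_pow, mul_pow, ← pow_mul 3, mul_comm i, pow_mul]; norm_num
      _ ≤ (4 * i + 2) ^ 4 * 81 ^ i * 2 ^ (2 * i + 92) := by
        refine Nat.mul_le_mul (Nat.mul_le_mul_right _ (Nat.pow_le_pow_left (by omega) 4))
          (hw.trans (Nat.pow_le_pow_right two_pos (by omega)))
      _ = 2 ^ 92 * (4 * i + 2) ^ 4 * 324 ^ i := by
        rw [pow_add, pow_mul, show 324 = 81 * 2 ^ 2 from rfl, mul_pow 81]; ring
  · have h2 := (Nat.choose_le_choose k hkn).trans hC'
    have h3 := h4.trans (Nat.mul_le_mul_left (2 * k) h2)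
    refine absurd (pow_twelve_lt hk2) (not_lt.mpr ?_)
    refine Nat.le_of_mul_le_mul_right (c := 2 ^ (23 * k)) ?_ (by positivity)
    calc 2 ^ k * 2 ^ (23 * k) = (4 ^ k) ^ 12 := by
          rw [← pow_add, show 4 = 2 ^ 2 from rfl, ← pow_mul, ← pow_mul]; congr 1; ring
      _ ≤ (2 * k * (4 ^ (n / 3) * W)) ^ 12 := Nat.pow_le_pow_left h3 12
      _ = (2 * k) ^ 12 * 2 ^ (24 * (n / 3)) * (W ^ 4) ^ 3 := by
        rw [mul_pow (2 * k), mul_pow (4 ^ _), ← pow_mul W, ← mul_assoc, ← pow_mul 4,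
          show 4 ^ (n / 3 * 12) = 2 ^ (24 * (n / 3)) by
            rw [show 4 = 2 ^ 2 from rfl, ← pow_mul]; congr 1; ring]
      _ ≤ (2 * k) ^ 12 * 2 ^ (20 * k) * (2 ^ (k + 91)) ^ 3 :=
        Nat.mul_le_mul (Nat.mul_le_mul_left _ (Nat.pow_le_pow_right two_pos (by omega)))
          (Nat.pow_le_pow_left hw 3)
      _ = (2 * k) ^ 12 * 2 ^ 273 * 2 ^ (23 * k) := by
        rw [← pow_mul, mul_assoc, mul_assoc, ← pow_add, ← pow_add]
        congr 2
        ring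

theorem g1_irreducible_or_linear_times_irreducible (n s : ℕ) (hn : 3 ≤ n) (hs : s ≤ 92) :
    Irreducible (g1 n s) ∨
      ∃ l q : ℚ[X], l.natDegree = 1 ∧ Irreducible q ∧ g1 n s = l * q := by
  refine g1_of_gz ?_
  rcases hn.eq_or_lt with rfl | hn
  · exact irreducible_or_of_three s
  · refine irreducible_or_of_noFactor hn fun k hk hkn => ?_
    rcases le_or_gt k 91 with h | h
    · exact noFactor_of_le hs hk h hkn
    · exact noFactor_of_ge hs h hkn
end

section
/- The polynomial g₁(x,n,s) is irreducible over ℚ for each pair (n,s) in the set {(4,7), (4,23), (9,19), (9,47), (16,14), (16,34), (16,89), (10,4)}. -/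
open Polynomial Finset

/-- Pocklington's primality criterion: `M` is the cofactor in `N - 1` of the product of the prime
powers `r ^ e` with `(r, e)` in `L`. -/
theorem Nat.Prime.of_pocklington {N : ℕ} (a : ℕ) (L : List (ℕ × ℕ)) (M : ℕ) (hN : 1 < N)
    (hF : (L.map fun x => x.1 ^ x.2).prod * M = N - 1)
    (hlt : N < (L.map fun x => x.1 ^ x.2).prod ^ 2)
    (ha : (a : ZMod N) ^ (N - 1) = 1)
    (hL : ∀ x ∈ L, x.1.Prime ∧
      ∃ c : ℕ, (a : ZMod N) ^ ((N - 1) / x.1) = c + 1 ∧ c.Coprime N) :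
    N.Prime := by
  set F := (L.map fun x => x.1 ^ x.2).prod with hFdef
  by_contra hNp
  have hq : N.minFac.Prime := Nat.minFac_prime hN.ne'
  set q := N.minFac with hqdef
  have hqN : q ∣ N := Nat.minFac_dvd N
  have hsq : q ^ 2 ≤ N := Nat.minFac_sq_le_self (by omega) hNp
  have : Fact q.Prime := ⟨hq⟩
  have hFpos : 0 < F := by
    rcases Nat.eq_zero_or_pos F with h | h
    · rw [h] at hF; omega
    · exact h
  have hφa (e c : ℕ) (h : (a : ZMod N) ^ e = c) : (a : ZMod q) ^ e = c := by
    simpa only [map_pow, map_natCast] using congrArg (ZMod.castHom hqN (ZMod q)) h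
  have hone : (a : ZMod q) ^ (N - 1) = 1 := by simpa using hφa (N - 1) 1 (by simpa using ha)
  have hord : orderOf ((a : ZMod q) ^ M) = F := by
    refine orderOf_eq_of_pow_and_pow_div_prime hFpos (by rw [← pow_mul, mul_comm, hF, hone]) ?_
    intro r hr hrF hpow
    obtain ⟨y, hy, hry⟩ := (Nat.Prime.prime hr).dvd_prod_iff.1 hrF
    obtain ⟨x, hx, rfl⟩ := List.mem_map.1 hy
    obtain ⟨hxp, c, hc, hcop⟩ := hL x hx
    obtain rfl : r = x.1 := (Nat.prime_dvd_prime_iff_eq hr hxp).1 (hr.dvd_of_dvd_pow hry)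
    have h1 := hφa _ (c + 1) (by simpa using hc)
    rw [← pow_mul, ← Nat.mul_div_assoc _ hrF, mul_comm M, hF, h1] at hpow
    have h0 : (c : ZMod q) = 0 := by simpa using hpow
    have hqc : q ∣ c := (ZMod.natCast_eq_zero_iff _ _).1 h0
    exact hq.one_lt.ne' (Nat.eq_one_of_dvd_coprimes hcop hqc hqN)
  have hne : (a : ZMod q) ^ M ≠ 0 := by
    intro h0
    have : ((a : ZMod q) ^ M) ^ F = 1 := by rw [← hord]; exact pow_orderOf_eq_one _
    rw [h0, zero_pow hFpos.ne'] at this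
    exact zero_ne_one this
  have hdvd := ZMod.orderOf_dvd_card_sub_one hne
  rw [hord] at hdvd
  have hle := Nat.le_of_dvd (Nat.sub_pos_of_lt hq.one_lt) hdvd
  have : F ^ 2 ≤ q ^ 2 := Nat.pow_le_pow_left (by omega) 2
  omega

theorem norm_add_pow_sub_pow_le (x : ℝ) (hx : 0 ≤ x) (w : ℂ) (j : ℕ) :
    ‖((x : ℂ) + w) ^ j - (x : ℂ) ^ j‖ ≤ (x + ‖w‖) ^ j - x ^ j := by
  induction j with
  | zero => simp
  | succ j ih =>
    have h1 : ((x : ℂ) + w) ^ (j + 1) - (x : ℂ) ^ (j + 1) =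
        (x + w) * ((x + w) ^ j - (x : ℂ) ^ j) + w * (x : ℂ) ^ j := by ring
    have h2 : ‖(x : ℂ) + w‖ ≤ x + ‖w‖ := by
      simpa [abs_of_nonneg hx] using norm_add_le (x : ℂ) w
    calc _ ≤ ‖(x : ℂ) + w‖ * ‖(x + w) ^ j - (x : ℂ) ^ j‖ + ‖w‖ * x ^ j := by
            rw [h1]
            refine (norm_add_le _ _).trans (le_of_eq ?_)
            simp [abs_of_nonneg hx]
      _ ≤ (x + ‖w‖) * ((x + ‖w‖) ^ j - x ^ j) + ‖w‖ * x ^ j := by gcongr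
      _ = _ := by ring

theorem Multiset.lt_prod_of_forall_lt {R : ℝ} (hR : 1 ≤ R) (s : Multiset ℝ) (hs : s ≠ 0)
    (h : ∀ x ∈ s, R < x) : R < s.prod := by
  induction s using Multiset.induction with
  | empty => exact absurd rfl hs
  | cons a s ih =>
    rw [Multiset.prod_cons]
    have ha := h a (Multiset.mem_cons_self a s)
    rcases eq_or_ne s 0 with rfl | hs0
    · simpa using ha
    · have := ih hs0 fun x hx => h x (Multiset.mem_cons_of_mem hx)
      nlinarith

/-- A monic integer polynomial with no complex root within distance `R` of `m` takes a value
larger than `R` at `m`. -/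
theorem lt_abs_eval_of_forall_root {g : ℤ[X]} (hg : g.Monic) (hdeg : g.natDegree ≠ 0) (m R : ℕ)
    (hR : 1 ≤ R) (hroot : ∀ z : ℂ, aeval z g = 0 → (R : ℝ) < ‖(m : ℂ) - z‖) :
    (R : ℤ) < |g.eval (m : ℤ)| := by
  set G := g.map (Int.castRingHom ℂ) with hG
  have hGm : G.Monic := hg.map _
  have hs : G.Splits := IsAlgClosed.splits G
  have hev := hs.eval_eq_prod_roots_of_monic hGm (m : ℂ)
  have hcard : G.roots ≠ 0 := by
    rw [← Multiset.card_pos, ← hs.natDegree_eq_card_roots, hG, hg.natDegree_map]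
    omega
  have hcast : ((g.eval (m : ℤ) : ℤ) : ℂ) = G.eval (m : ℂ) := by
    simp [hG]
  have hlt : (R : ℝ) < ((G.roots.map fun z => ‖(m : ℂ) - z‖)).prod := by
    refine Multiset.lt_prod_of_forall_lt (by exact_mod_cast hR) _ (by simpa using hcard) ?_
    intro x hx
    obtain ⟨z, hz, rfl⟩ := Multiset.mem_map.1 hx
    refine hroot z ?_
    have := (mem_roots'.1 hz).2
    rwa [IsRoot, hG, eval_map] at this
  have hnorm : ‖G.eval (m : ℂ)‖ = ((G.roots.map fun z => ‖(m : ℂ) - z‖)).prod := by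
    rw [hev]
    exact (Multiset.prod_hom' G.roots (normHom : ℂ →*₀ ℝ) fun z => (m : ℂ) - z).symm
  rw [← hnorm, ← hcast, Complex.norm_intCast] at hlt
  exact_mod_cast hlt

/-- If a monic integer polynomial with nonnegative coefficients grows by a factor less than two
from `m` to `m + R`, and its value at `m` is a prime times a cofactor at most `R`, then it is
irreducible. -/
theorem irreducible_of_eval_eq_mul_prime {f : ℤ[X]} (hf : f.Monic) (hcoeff : ∀ j, 0 ≤ f.coeff j)
    (hdeg : f.natDegree ≠ 0) (m R k p : ℕ) (hp : p.Prime) (hk : 1 ≤ k) (hkR : k ≤ R)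
    (hval : f.eval (m : ℤ) = k * p)
    (hlt : f.eval ((m + R : ℕ) : ℤ) < 2 * f.eval (m : ℤ)) : Irreducible f := by
  have hroot : ∀ z : ℂ, aeval z f = 0 → (R : ℝ) < ‖(m : ℂ) - z‖ := by
    intro z hz
    by_contra! hle
    have hw : ‖z - (m : ℂ)‖ ≤ R := by rwa [norm_sub_rev]
    have key : ‖aeval z f - aeval (m : ℂ) f‖ ≤ aeval ((m : ℝ) + R) f - aeval (m : ℝ) f := by
      simp only [aeval_eq_sum_range, ← Finset.sum_sub_distrib, ← smul_sub]
      refine (norm_sum_le _ _).trans (Finset.sum_le_sum fun j _ => ?_)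
      have hc : (0 : ℝ) ≤ f.coeff j := by exact_mod_cast hcoeff j
      rw [zsmul_eq_mul, zsmul_eq_mul, norm_mul, Complex.norm_intCast, abs_of_nonneg hc]
      refine mul_le_mul_of_nonneg_left ?_ hc
      have := norm_add_pow_sub_pow_le (m : ℝ) (by positivity) (z - m) j
      simp only [Complex.ofReal_natCast, add_sub_cancel] at this
      refine this.trans ?_
      gcongr
    have e1 : aeval (m : ℂ) f = ((f.eval (m : ℤ) : ℤ) : ℂ) := by
      simpa using aeval_algebraMap_apply ℂ (m : ℤ) f
    have e2 : aeval (m : ℝ) f = ((f.eval (m : ℤ) : ℤ) : ℝ) := by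
      simpa using aeval_algebraMap_apply ℝ (m : ℤ) f
    have e3 : aeval ((m : ℝ) + R) f = ((f.eval ((m + R : ℕ) : ℤ) : ℤ) : ℝ) := by
      simpa using aeval_algebraMap_apply ℝ ((m + R : ℕ) : ℤ) f
    rw [hz, zero_sub, norm_neg, e1, e2, e3, Complex.norm_intCast] at key
    have key' : |f.eval (m : ℤ)| ≤ f.eval ((m + R : ℕ) : ℤ) - f.eval (m : ℤ) := by
      exact_mod_cast key
    have := le_abs_self (f.eval (m : ℤ))
    omega
  have hR : 1 ≤ R := hk.trans hkR
  have small : ∀ g h : ℤ[X], g.Monic → g * h = f → (p : ℤ) ∣ h.eval (m : ℤ) →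
      g.natDegree = 0 := by
    intro g h hg hgh hph
    by_contra hg0
    have hgt := lt_abs_eval_of_forall_root hg hg0 m R hR fun z hz => hroot z (by
      rw [← hgh, map_mul, hz, zero_mul])
    obtain ⟨c, hc⟩ := hph
    have hmul : g.eval (m : ℤ) * h.eval (m : ℤ) = k * p := by rw [← eval_mul, hgh, hval]
    rw [hc] at hmul
    have hp0 : (p : ℤ) ≠ 0 := by exact_mod_cast hp.ne_zero
    have hgc : g.eval (m : ℤ) * c = k :=
      mul_right_cancel₀ hp0 (by rw [← hmul]; ring)
    have hle := Int.le_of_dvd (by omega) ((abs_dvd _ _).2 ⟨c, hgc.symm⟩)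
    omega
  refine hf.irreducible_iff_natDegree.2 ⟨?_, ?_⟩
  · rintro rfl
    simp at hdeg
  intro g h hg hh hgh
  have hdvd : (p : ℤ) ∣ g.eval (m : ℤ) * h.eval (m : ℤ) := by
    rw [← eval_mul, hgh, hval]
    exact dvd_mul_left _ _
  rcases (Nat.prime_iff_prime_int.1 hp).dvd_or_dvd hdvd with hd | hd
  · exact Or.inr (small h g hh (by rw [mul_comm, hgh]) hd)
  · exact Or.inl (small g h hg hgh hd)

/-- The coefficient of `x ^ j` in `g1 n s`. -/
def g1Coeff (n s j : ℕ) : ℕ :=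
  n.descFactorial (n - j) * (n + s - j).choose (n - j)

/-- The integer polynomial underlying `g1 n s`. -/
noncomputable def g1Int (n s : ℕ) : ℤ[X] :=
  ∑ j ∈ Finset.range (n + 1), C (g1Coeff n s j : ℤ) * X ^ j

theorem map_g1Int (n s : ℕ) : (g1Int n s).map (algebraMap ℤ ℚ) = g1 n s := by
  rw [g1Int, g1, Polynomial.map_sum, Finset.mul_sum]
  refine Finset.sum_congr rfl fun j hj => ?_
  have hj' : j ≤ n := Nat.lt_succ_iff.1 (Finset.mem_range.1 hj)
  have h : (j.factorial : ℚ) * n.descFactorial (n - j) = n.factorial := by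
    have := Nat.factorial_mul_descFactorial (Nat.sub_le n j)
    rw [Nat.sub_sub_self hj'] at this
    exact_mod_cast this
  have hj0 : (j.factorial : ℚ) ≠ 0 := by exact_mod_cast j.factorial_ne_zero
  rw [← map_natCast (C : ℚ →+* ℚ[X]), ← mul_assoc, ← C_mul, Polynomial.map_mul,
    Polynomial.map_pow, map_X, map_C]
  congr 2
  rw [g1Coeff, ← h]
  simp
  field_simp

theorem coeff_g1Int (n s j : ℕ) :
    (g1Int n s).coeff j = if j < n + 1 then (g1Coeff n s j : ℤ) else 0 := by
  simp [g1Int, coeff_X_pow]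

theorem g1Int_natDegree_monic (n s : ℕ) : (g1Int n s).natDegree = n ∧ (g1Int n s).Monic := by
  have hn : (g1Int n s).coeff n = 1 := by simp [coeff_g1Int, g1Coeff]
  have hle : (g1Int n s).natDegree ≤ n :=
    natDegree_le_iff_coeff_eq_zero.2 fun j hj => by
      rw [coeff_g1Int, if_neg (by omega)]
  exact ⟨le_antisymm hle (le_natDegree_of_ne_zero (by rw [hn]; exact one_ne_zero)),
    monic_of_natDegree_le_of_coeff_eq_one n hle hn⟩

theorem eval_g1Int (n s x : ℕ) :
    (g1Int n s).eval (x : ℤ) =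
      ((∑ j ∈ Finset.range (n + 1), g1Coeff n s j * x ^ j : ℕ) : ℤ) := by
  simp [g1Int, eval_finsetSum]

theorem irreducible_g1 (n s m R k p : ℕ) (hn : n ≠ 0) (hp : p.Prime) (hk : 1 ≤ k) (hkR : k ≤ R)
    (hval : ∑ j ∈ Finset.range (n + 1), g1Coeff n s j * m ^ j = k * p)
    (hlt : ∑ j ∈ Finset.range (n + 1), g1Coeff n s j * (m + R) ^ j < 2 * (k * p)) :
    Irreducible (g1 n s) := by
  obtain ⟨hdeg, hmonic⟩ := g1Int_natDegree_monic n s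
  rw [← map_g1Int, ← hmonic.irreducible_iff_irreducible_map_fraction_map]
  refine irreducible_of_eval_eq_mul_prime hmonic (fun j => ?_) (by rwa [hdeg]) m R k p hp hk hkR
    ?_ ?_
  · rw [coeff_g1Int]
    split_ifs <;> positivity
  · rw [eval_g1Int, hval]
    push_cast
    rfl
  · rw [eval_g1Int, eval_g1Int, hval]
    exact_mod_cast hlt

theorem prime_3015080818138048217 :
    Nat.Prime 3015080818138048217 := by
  refine Nat.Prime.of_pocklington 3 [(2, 3), (151, 1), (1237, 1), (47591, 1)]
    42397231 (by norm_num) (by norm_num) (by norm_num)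
    (by reduce_mod_char) ?_
  simp only [List.forall_mem_cons, List.not_mem_nil, false_imp_iff, implies_true, and_true]
  refine ⟨⟨by norm_num, 3015080818138048215,
      by reduce_mod_char, by norm_num⟩,
    ⟨by norm_num, 928202543288974558,
      by reduce_mod_char, by norm_num⟩,
    ⟨by norm_num, 3748359006908419,
      by reduce_mod_char, by norm_num⟩,
    ⟨by norm_num, 324382976602112666,
      by reduce_mod_char, by norm_num⟩⟩

theorem prime_7126106689655381102511169 :
    Nat.Prime 7126106689655381102511169 := by
  refine Nat.Prime.of_pocklington 23 [(2, 6), (3, 2), (41, 1), (433, 1), (919, 1), (1021, 1)]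
    742705825219 (by norm_num) (by norm_num) (by norm_num)
    (by reduce_mod_char) ?_
  simp only [List.forall_mem_cons, List.not_mem_nil, false_imp_iff, implies_true, and_true]
  refine ⟨⟨by norm_num, 7126106689655381102511167,
      by reduce_mod_char, by norm_num⟩,
    ⟨by norm_num, 576598328149045561882894,
      by reduce_mod_char, by norm_num⟩,
    ⟨by norm_num, 1044699321279858238330925,
      by reduce_mod_char, by norm_num⟩,
    ⟨by norm_num, 6452755180154126421584238,
      by reduce_mod_char, by norm_num⟩,
    ⟨by norm_num, 3400127835602720446400774,
      by reduce_mod_char, by norm_num⟩,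
    ⟨by norm_num, 2810989002249212605750864,
      by reduce_mod_char, by norm_num⟩⟩

theorem prime_158322332791305029 :
    Nat.Prime 158322332791305029 := by
  refine Nat.Prime.of_pocklington 2 [(2, 2), (193, 1), (293, 1), (35291, 1)]
    19833223 (by norm_num) (by norm_num) (by norm_num)
    (by reduce_mod_char) ?_
  simp only [List.forall_mem_cons, List.not_mem_nil, false_imp_iff, implies_true, and_true]
  refine ⟨⟨by norm_num, 158322332791305027,
      by reduce_mod_char, by norm_num⟩,
    ⟨by norm_num, 68508514744377003,
      by reduce_mod_char, by norm_num⟩,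
    ⟨by norm_num, 87953355711845501,
      by reduce_mod_char, by norm_num⟩,
    ⟨by norm_num, 133932660075193895,
      by reduce_mod_char, by norm_num⟩⟩

theorem prime_1534060617173975522241549135281287441 :
    Nat.Prime 1534060617173975522241549135281287441 := by
  refine Nat.Prime.of_pocklington 11 [(2, 4), (3, 2), (5, 1), (7, 2), (31, 1), (3671, 1), (21977, 1),
    (238361, 1)]
    72939748080388909 (by norm_num) (by norm_num) (by norm_num)
    (by reduce_mod_char) ?_
  simp only [List.forall_mem_cons, List.not_mem_nil, false_imp_iff, implies_true, and_true]
  refine ⟨⟨by norm_num, 1534060617173975522241549135281287439,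
      by reduce_mod_char, by norm_num⟩,
    ⟨by norm_num, 1136222079416886958327469965711044710,
      by reduce_mod_char, by norm_num⟩,
    ⟨by norm_num, 588025413166440853331025758998743814,
      by reduce_mod_char, by norm_num⟩,
    ⟨by norm_num, 161157849526201484149191297537604369,
      by reduce_mod_char, by norm_num⟩,
    ⟨by norm_num, 661640932778263907230831781102550420,
      by reduce_mod_char, by norm_num⟩,
    ⟨by norm_num, 299772161356404565643362098781294101,
      by reduce_mod_char, by norm_num⟩,
    ⟨by norm_num, 1386281063695215950981149882412220472,
      by reduce_mod_char, by norm_num⟩,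
    ⟨by norm_num, 1407016381903662091559264904556262345,
      by reduce_mod_char, by norm_num⟩⟩

theorem prime_591620134346389829937315333670555665016530161 :
    Nat.Prime 591620134346389829937315333670555665016530161 := by
  refine Nat.Prime.of_pocklington 6 [(2, 4), (5, 1), (31, 1), (113, 1), (619, 1), (1459, 1), (6163, 1),
    (114857173, 1)]
    3302300498260834853971 (by norm_num) (by norm_num) (by norm_num)
    (by reduce_mod_char) ?_
  simp only [List.forall_mem_cons, List.not_mem_nil, false_imp_iff, implies_true, and_true]
  refine ⟨⟨by norm_num, 591620134346389829937315333670555665016530159,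
      by reduce_mod_char, by norm_num⟩,
    ⟨by norm_num, 223234736886163036207638889343939345980950548,
      by reduce_mod_char, by norm_num⟩,
    ⟨by norm_num, 459411699808523025374094475896405361585856285,
      by reduce_mod_char, by norm_num⟩,
    ⟨by norm_num, 175044389084339707498211948013980324590654283,
      by reduce_mod_char, by norm_num⟩,
    ⟨by norm_num, 458876140845577607732999245623842621025609814,
      by reduce_mod_char, by norm_num⟩,
    ⟨by norm_num, 103667712351621233134181915134543034425144952,
      by reduce_mod_char, by norm_num⟩,
    ⟨by norm_num, 191925591116025792975543306345825309208640746,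
      by reduce_mod_char, by norm_num⟩,
    ⟨by norm_num, 140756697873735963677800866442760826486173455,
      by reduce_mod_char, by norm_num⟩⟩

theorem prime_3560640697971915212664116720071122168883730427151920721 :
    Nat.Prime 3560640697971915212664116720071122168883730427151920721 := by
  refine Nat.Prime.of_pocklington 7 [(2, 4), (3, 1), (5, 1), (41, 1), (43, 1), (401, 1), (827851, 1),
    (6916001, 1), (21626203, 1)]
    169485568505077965420383777 (by norm_num) (by norm_num) (by norm_num)
    (by reduce_mod_char) ?_
  simp only [List.forall_mem_cons, List.not_mem_nil, false_imp_iff, implies_true, and_true]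
  refine ⟨⟨by norm_num, 3560640697971915212664116720071122168883730427151920719,
      by reduce_mod_char, by norm_num⟩,
    ⟨by norm_num, 2937853377817935422402378149667205630286619973580215216,
      by reduce_mod_char, by norm_num⟩,
    ⟨by norm_num, 2978488286132182073166600947835229718250744137777894240,
      by reduce_mod_char, by norm_num⟩,
    ⟨by norm_num, 424221296491308160162911506504532864197233181055605657,
      by reduce_mod_char, by norm_num⟩,
    ⟨by norm_num, 466693348826736849466613018463457082106487065268933614,
      by reduce_mod_char, by norm_num⟩,
    ⟨by norm_num, 3227589437425935180235221822740864301766131318258003079,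
      by reduce_mod_char, by norm_num⟩,
    ⟨by norm_num, 274725481779126281100815639400745302042252375828822601,
      by reduce_mod_char, by norm_num⟩,
    ⟨by norm_num, 1270989526338275199594612979384297998868278559351161723,
      by reduce_mod_char, by norm_num⟩,
    ⟨by norm_num, 142112694364957531795063254376687309537944677187110729,
      by reduce_mod_char, by norm_num⟩⟩

theorem g1_irreducible_special_pairs (n s : ℕ)
    (h : (n, s) ∈ ({(4, 7), (4, 23), (9, 19), (9, 47), (16, 14), (16, 34),
      (16, 89), (10, 4)} : Set (ℕ × ℕ))) : Irreducible (g1 n s) := by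
  simp only [Set.mem_insert_iff, Set.mem_singleton_iff, Prod.mk.injEq] at h
  rcases h with ⟨rfl, rfl⟩ | ⟨rfl, rfl⟩ | ⟨rfl, rfl⟩ | ⟨rfl, rfl⟩ | ⟨rfl, rfl⟩ | ⟨rfl, rfl⟩ |
    ⟨rfl, rfl⟩ | ⟨rfl, rfl⟩
  · exact irreducible_g1 4 7 19 5 3 189467
      (by norm_num) (by norm_num) (by norm_num) (by norm_num)
      (by simp [Finset.sum_range_succ, g1Coeff, Nat.descFactorial,
        Nat.choose_eq_descFactorial_div_factorial, Nat.factorial])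
      (by simp [Finset.sum_range_succ, g1Coeff, Nat.descFactorial,
        Nat.choose_eq_descFactorial_div_factorial, Nat.factorial])
  · exact irreducible_g1 4 23 11 6 1 1685617
      (by norm_num) (by norm_num) (by norm_num) (by norm_num)
      (by simp [Finset.sum_range_succ, g1Coeff, Nat.descFactorial,
        Nat.choose_eq_descFactorial_div_factorial, Nat.factorial])
      (by simp [Finset.sum_range_succ, g1Coeff, Nat.descFactorial,
        Nat.choose_eq_descFactorial_div_factorial, Nat.factorial])
  · exact irreducible_g1 9 19 127 11 11 3015080818138048217
      (by norm_num) prime_3015080818138048217 (by norm_num) (by norm_num)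
      (by simp [Finset.sum_range_succ, g1Coeff, Nat.descFactorial,
        Nat.choose_eq_descFactorial_div_factorial, Nat.factorial])
      (by simp [Finset.sum_range_succ, g1Coeff, Nat.descFactorial,
        Nat.choose_eq_descFactorial_div_factorial, Nat.factorial])
  · exact irreducible_g1 9 47 529 46 1 7126106689655381102511169
      (by norm_num) prime_7126106689655381102511169 (by norm_num) (by norm_num)
      (by simp [Finset.sum_range_succ, g1Coeff, Nat.descFactorial,
        Nat.choose_eq_descFactorial_div_factorial, Nat.factorial])
      (by simp [Finset.sum_range_succ, g1Coeff, Nat.descFactorial,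
        Nat.choose_eq_descFactorial_div_factorial, Nat.factorial])
  · exact irreducible_g1 16 14 167 8 1 1534060617173975522241549135281287441
      (by norm_num) prime_1534060617173975522241549135281287441 (by norm_num) (by norm_num)
      (by simp [Finset.sum_range_succ, g1Coeff, Nat.descFactorial,
        Nat.choose_eq_descFactorial_div_factorial, Nat.factorial])
      (by simp [Finset.sum_range_succ, g1Coeff, Nat.descFactorial,
        Nat.choose_eq_descFactorial_div_factorial, Nat.factorial])
  · exact irreducible_g1 16 34 593 27 1 591620134346389829937315333670555665016530161
      (by norm_num) prime_591620134346389829937315333670555665016530161 (by norm_num) (by norm_num)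
      (by simp [Finset.sum_range_succ, g1Coeff, Nat.descFactorial,
        Nat.choose_eq_descFactorial_div_factorial, Nat.factorial])
      (by simp [Finset.sum_range_succ, g1Coeff, Nat.descFactorial,
        Nat.choose_eq_descFactorial_div_factorial, Nat.factorial])
  · exact irreducible_g1 16 89 2477 113 1 3560640697971915212664116720071122168883730427151920721
      (by norm_num) prime_3560640697971915212664116720071122168883730427151920721 (by norm_num)
      (by norm_num)
      (by simp [Finset.sum_range_succ, g1Coeff, Nat.descFactorial,
        Nat.choose_eq_descFactorial_div_factorial, Nat.factorial])
      (by simp [Finset.sum_range_succ, g1Coeff, Nat.descFactorial,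
        Nat.choose_eq_descFactorial_div_factorial, Nat.factorial])
  · exact irreducible_g1 10 4 47 3 1 158322332791305029
      (by norm_num) prime_158322332791305029 (by norm_num) (by norm_num)
      (by simp [Finset.sum_range_succ, g1Coeff, Nat.descFactorial,
        Nat.choose_eq_descFactorial_div_factorial, Nat.factorial])
      (by simp [Finset.sum_range_succ, g1Coeff, Nat.descFactorial,
        Nat.choose_eq_descFactorial_div_factorial, Nat.factorial])
end
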